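/- arXiv:2508.19480 — 7 statements merged into one kernel-verified Lean document; each statement's English description precedes it below -/
import Mathlib

section
/- The operators satisfy the commutation relation [T_X, T_Y] = −(K/2)·T_Z as linear operators on D, where [S,T] = S∘T − T∘S. -/
noncomputable section

/-- The Hilbert space `ℓ²(ℤ, ℂ)` of square-summable complex sequences indexed by `ℤ`. -/
abbrev HS : Type := lp (fun _ : ℤ => ℂ) 2

/-- The standard orthonormal basis vectors of `ℓ²(ℤ, ℂ)`. -/
noncomputable def e (k : ℤ) : HS := lp.single 2 k 1

/-- The dense subspace of finitely supported sequences, i.e. the span of the basis vectors. -/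
def Dfin : Submodule ℂ HS := Submodule.span ℂ (Set.range e)

lemma e_mem (k : ℤ) : e k ∈ Dfin := Submodule.subset_span ⟨k, rfl⟩

/-- The basis vectors, viewed as elements of the subspace `Dfin`. -/
noncomputable def eD (k : ℤ) : Dfin := ⟨e k, e_mem k⟩

/-- Two linear maps on `Dfin` agreeing on all basis vectors are equal. -/
lemma Dfin_hom_ext {M : Type*} [AddCommGroup M] [Module ℂ M] {S T : Dfin →ₗ[ℂ] M}
    (h : ∀ k : ℤ, S (eD k) = T (eD k)) : S = T := by
  refine LinearMap.ext_on_range (v := eD) ?_ h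
  have hr : Set.range eD = ((↑) : Dfin → HS) ⁻¹' Set.range e := by
    ext x
    simp only [Set.mem_range, Set.mem_preimage, eD, Subtype.ext_iff]
  rw [hr]
  exact Submodule.span_span_coe_preimage

/-- The commutation relation `[T_X, T_Y] = -(K/2) T_Z` on `Dfin`. -/
theorem commutator_TX_TY
    (K : ℝ) (hK : K < 0) (c : ℤ → ℝ)
    (hc : ∀ p : ℤ, 1 ≤ p → c p = (1 / 2) * (1 - ((p : ℝ) * ((p : ℝ) - 1) / 2) * K))
    (TX TY TZ : Dfin →ₗ[ℂ] Dfin)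
    (hTX_neg : ∀ k : ℤ, k ≤ -2 → TX (eD k) = (-(Real.sqrt (c (-k)) : ℂ)) • eD (k + 1))
    (hTX_m1 : TX (eD (-1)) = (-((1 / Real.sqrt 2 : ℝ) : ℂ)) • eD 0)
    (hTX_0 : TX (eD 0) = ((1 / Real.sqrt 2 : ℝ) : ℂ) • eD 1)
    (hTX_pos : ∀ k : ℤ, 1 ≤ k → TX (eD k) = ((Real.sqrt (c (k + 1)) : ℝ) : ℂ) • eD (k + 1))
    (hTY_neg : ∀ k : ℤ, k ≤ -1 → TY (eD k) = ((Real.sqrt (c (-k + 1)) : ℝ) : ℂ) • eD (k - 1))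
    (hTY_0 : TY (eD 0) = ((1 / Real.sqrt 2 : ℝ) : ℂ) • eD (-1))
    (hTY_1 : TY (eD 1) = (-((1 / Real.sqrt 2 : ℝ) : ℂ)) • eD 0)
    (hTY_pos : ∀ k : ℤ, 2 ≤ k → TY (eD k) = (-(Real.sqrt (c k) : ℂ)) • eD (k - 1))
    (hTZ : ∀ k : ℤ, TZ (eD k) = (k : ℂ) • eD k)
    :
    TX ∘ₗ TY - TY ∘ₗ TX = ((-(K / 2) : ℝ) : ℂ) • TZ := by
  have hc1 : Real.sqrt (c 1) = 1 / Real.sqrt 2 := by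
    rw [hc 1 le_rfl, one_div (Real.sqrt 2), ← Real.sqrt_inv]
    norm_num
  have hsq (p : ℤ) (hp : 1 ≤ p) :
      (Real.sqrt (c p) : ℂ) * (Real.sqrt (c p) : ℂ)
        = (1 / 2) * (1 - ((p : ℂ) * ((p : ℂ) - 1) / 2) * K) := by
    have h0 : 0 ≤ c p := by
      have hp' : (1 : ℝ) ≤ p := by exact_mod_cast hp
      have : 0 ≤ (p : ℝ) * ((p : ℝ) - 1) := mul_nonneg (by linarith) (by linarith)
      rw [hc p hp]
      nlinarith
    rw [← Complex.ofReal_mul, Real.mul_self_sqrt h0, hc p hp]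
    push_cast
    ring
  have hX_neg (k : ℤ) (hk : k ≤ -1) :
      TX (eD k) = (-(Real.sqrt (c (-k)) : ℂ)) • eD (k + 1) := by
    rcases hk.eq_or_lt with rfl | h
    · simpa [hc1] using hTX_m1
    · exact hTX_neg k (by omega)
  have hX_pos (k : ℤ) (hk : 0 ≤ k) :
      TX (eD k) = (Real.sqrt (c (k + 1)) : ℂ) • eD (k + 1) := by
    rcases hk.eq_or_lt with rfl | h
    · simpa [hc1] using hTX_0
    · exact hTX_pos k (by omega)
  have hY_neg (k : ℤ) (hk : k ≤ 0) :
      TY (eD k) = (Real.sqrt (c (-k + 1)) : ℂ) • eD (k - 1) := by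
    rcases hk.eq_or_lt with rfl | h
    · simpa [hc1] using hTY_0
    · exact hTY_neg k (by omega)
  have hY_pos (k : ℤ) (hk : 1 ≤ k) :
      TY (eD k) = (-(Real.sqrt (c k) : ℂ)) • eD (k - 1) := by
    rcases hk.eq_or_lt with rfl | h
    · simpa [hc1] using hTY_1
    · exact hTY_pos k (by omega)
  have hXY_neg (k : ℤ) (hk : k ≤ 0) :
      TX (TY (eD k)) = (-((Real.sqrt (c (-k + 1)) : ℂ) * (Real.sqrt (c (-k + 1)) : ℂ))) • eD k := by
    rw [hY_neg k hk, map_smul, hX_neg (k - 1) (by omega), smul_smul, sub_add_cancel,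
      show -(k - 1) = -k + 1 by ring, mul_neg]
  have hXY_pos (k : ℤ) (hk : 1 ≤ k) :
      TX (TY (eD k)) = (-((Real.sqrt (c k) : ℂ) * (Real.sqrt (c k) : ℂ))) • eD k := by
    rw [hY_pos k hk, map_smul, hX_pos (k - 1) (by omega), smul_smul, sub_add_cancel, neg_mul]
  have hYX_neg (k : ℤ) (hk : k ≤ -1) :
      TY (TX (eD k)) = (-((Real.sqrt (c (-k)) : ℂ) * (Real.sqrt (c (-k)) : ℂ))) • eD k := by
    rw [hX_neg k hk, map_smul, hY_neg (k + 1) (by omega), smul_smul, add_sub_cancel_right,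
      show -(k + 1) + 1 = -k by ring, neg_mul]
  have hYX_pos (k : ℤ) (hk : 0 ≤ k) :
      TY (TX (eD k)) = (-((Real.sqrt (c (k + 1)) : ℂ) * (Real.sqrt (c (k + 1)) : ℂ))) • eD k := by
    rw [hX_pos k hk, map_smul, hY_pos (k + 1) (by omega), smul_smul, add_sub_cancel_right, mul_neg]
  refine Dfin_hom_ext fun k => ?_
  rw [LinearMap.sub_apply, LinearMap.comp_apply, LinearMap.comp_apply, LinearMap.smul_apply,
    hTZ, smul_smul]
  rcases lt_trichotomy k 0 with hk | rfl | hk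
  · rw [hXY_neg k hk.le, hYX_neg k (by omega), ← sub_smul, hsq _ (by omega), hsq _ (by omega)]
    congr 1
    push_cast
    ring
  · rw [hXY_neg 0 le_rfl, hYX_pos 0 le_rfl]
    simp
  · rw [hXY_pos k hk, hYX_pos k hk.le, ← sub_smul, hsq _ hk, hsq _ (by omega)]
    congr 1
    push_cast
    ring
end
end

section
/- Set F₁ = T_X + T_Y, F₂ = i·(T_X − T_Y), and F₃ = −i·T_Z as linear operators on D. Then the following bracket relations hold on D: [F₁, F₂] = |K|·F₃, [F₂, F₃] = −F₁, and [F₃, F₁] = −F₂, where [S,T] = S∘T − T∘S and |K| = −K since K < 0. -/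
noncomputable section

/-- Linear endomorphisms of `Dfin` that agree on the basis vectors are equal. -/
lemma Dfin_hom_ext_s7 {f g : Dfin →ₗ[ℂ] Dfin} (h : ∀ k, f (eD k) = g (eD k)) : f = g := by
  refine LinearMap.ext_on (s := Set.range eD) ?_ ?_
  · refine Eq.trans ?_ (Submodule.span_span_coe_preimage (R := ℂ) (s := Set.range e))
    congr 1
    ext x
    exact exists_congr fun k => Subtype.ext_iff
  · rintro _ ⟨k, rfl⟩
    exact h k

/-- The weighted shifts `X e_k = a_k e_{k+1}` and `Y e_k = -a_{k-1} e_{k-1}` have diagonal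
commutator. -/
lemma weighted_shift_commutator {X Y : Dfin →ₗ[ℂ] Dfin} {a : ℤ → ℂ}
    (hX : ∀ k, X (eD k) = a k • eD (k + 1)) (hY : ∀ k, Y (eD k) = -a (k - 1) • eD (k - 1))
    (k : ℤ) : X (Y (eD k)) - Y (X (eD k)) = (a k ^ 2 - a (k - 1) ^ 2) • eD k := by
  rw [hX, hY, map_smul, map_smul, hX, hY, sub_add_cancel, add_sub_cancel_right]
  module

/-- With `F₁ = T_X + T_Y`, `F₂ = i(T_X - T_Y)`, `F₃ = -i T_Z`, the bracket relations
`[F₁,F₂] = |K| F₃`, `[F₂,F₃] = -F₁`, `[F₃,F₁] = -F₂` hold on `Dfin`. -/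
theorem commutators_F
    (K : ℝ) (hK : K < 0) (c : ℤ → ℝ)
    (hc : ∀ p : ℤ, 1 ≤ p → c p = (1 / 2) * (1 - ((p : ℝ) * ((p : ℝ) - 1) / 2) * K))
    (TX TY TZ : Dfin →ₗ[ℂ] Dfin)
    (hTX_neg : ∀ k : ℤ, k ≤ -2 → TX (eD k) = (-(Real.sqrt (c (-k)) : ℂ)) • eD (k + 1))
    (hTX_m1 : TX (eD (-1)) = (-((1 / Real.sqrt 2 : ℝ) : ℂ)) • eD 0)
    (hTX_0 : TX (eD 0) = ((1 / Real.sqrt 2 : ℝ) : ℂ) • eD 1)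
    (hTX_pos : ∀ k : ℤ, 1 ≤ k → TX (eD k) = ((Real.sqrt (c (k + 1)) : ℝ) : ℂ) • eD (k + 1))
    (hTY_neg : ∀ k : ℤ, k ≤ -1 → TY (eD k) = ((Real.sqrt (c (-k + 1)) : ℝ) : ℂ) • eD (k - 1))
    (hTY_0 : TY (eD 0) = ((1 / Real.sqrt 2 : ℝ) : ℂ) • eD (-1))
    (hTY_1 : TY (eD 1) = (-((1 / Real.sqrt 2 : ℝ) : ℂ)) • eD 0)
    (hTY_pos : ∀ k : ℤ, 2 ≤ k → TY (eD k) = (-(Real.sqrt (c k) : ℂ)) • eD (k - 1))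
    (hTZ : ∀ k : ℤ, TZ (eD k) = (k : ℂ) • eD k)
    :
    let F1 : Dfin →ₗ[ℂ] Dfin := TX + TY
    let F2 : Dfin →ₗ[ℂ] Dfin := Complex.I • (TX - TY)
    let F3 : Dfin →ₗ[ℂ] Dfin := (-Complex.I) • TZ
    F1 ∘ₗ F2 - F2 ∘ₗ F1 = ((|K| : ℝ) : ℂ) • F3 ∧
    F2 ∘ₗ F3 - F3 ∘ₗ F2 = -F1 ∧
    F3 ∘ₗ F1 - F1 ∘ₗ F3 = -F2 := by
  have hs : Real.sqrt (c 1) = 1 / Real.sqrt 2 := by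
    rw [hc 1 le_rfl]
    norm_num
  have hcnn : ∀ p : ℤ, 1 ≤ p → 0 ≤ c p := by
    intro p hp
    have hp' : (1 : ℝ) ≤ p := by exact_mod_cast hp
    have : 0 ≤ (p : ℝ) * ((p : ℝ) - 1) / 2 * -K :=
      mul_nonneg (div_nonneg (mul_nonneg (by linarith) (by linarith)) (by norm_num)) (by linarith)
    rw [hc p hp]
    linarith
  obtain ⟨a, ha_neg, ha_nonneg⟩ : ∃ a : ℤ → ℝ,
      (∀ k < 0, a k = -Real.sqrt (c (-k))) ∧ ∀ k, 0 ≤ k → a k = Real.sqrt (c (k + 1)) :=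
    ⟨fun k => if k < 0 then -Real.sqrt (c (-k)) else Real.sqrt (c (k + 1)),
      fun k hk => if_pos hk, fun k hk => if_neg (not_lt.mpr hk)⟩
  have hasq : ∀ k, a k ^ 2 = 1 / 2 * (1 - (k : ℝ) * (k + 1) / 2 * K) := by
    intro k
    rcases lt_or_ge k 0 with hk | hk
    · rw [ha_neg k hk, neg_sq, Real.sq_sqrt (hcnn _ (by omega)), hc _ (by omega)]
      push_cast
      ring
    · rw [ha_nonneg k hk, Real.sq_sqrt (hcnn _ (by omega)), hc _ (by omega)]
      push_cast
      ring
  have hX : ∀ k, TX (eD k) = (a k : ℂ) • eD (k + 1) := by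
    intro k
    obtain hk | rfl | rfl | hk : k ≤ -2 ∨ k = -1 ∨ k = 0 ∨ 1 ≤ k := by omega
    · rw [hTX_neg k hk, ha_neg k (by omega), Complex.ofReal_neg]
    · rw [hTX_m1, ha_neg _ (by omega), neg_neg, hs, Complex.ofReal_neg]
      rfl
    · rw [hTX_0, ha_nonneg _ le_rfl, zero_add, hs]
    · rw [hTX_pos k hk, ha_nonneg k (by omega)]
  have hY : ∀ k, TY (eD k) = -(a (k - 1) : ℂ) • eD (k - 1) := by
    intro k
    obtain hk | rfl | rfl | hk : k ≤ -1 ∨ k = 0 ∨ k = 1 ∨ 2 ≤ k := by omega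
    · rw [hTY_neg k hk, ha_neg _ (by omega), Complex.ofReal_neg, neg_neg,
        show -(k - 1) = -k + 1 by ring]
    · rw [hTY_0, ha_neg _ (by omega), Complex.ofReal_neg, neg_neg, zero_sub, neg_neg, hs]
    · rw [hTY_1, sub_self, ha_nonneg _ le_rfl, zero_add, hs]
    · rw [hTY_pos k hk, ha_nonneg _ (by omega), sub_add_cancel]
  have hXY : ∀ k, TX (TY (eD k)) - TY (TX (eD k)) = (-(K : ℂ) / 2 * k) • eD k := by
    intro k
    rw [weighted_shift_commutator (a := fun k => (a k : ℂ)) hX hY]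
    congr 1
    have h : a k ^ 2 - a (k - 1) ^ 2 = -K / 2 * k := by
      rw [hasq, hasq]
      push_cast
      ring
    exact_mod_cast h
  have hZX : ∀ k, TZ (TX (eD k)) - TX (TZ (eD k)) = TX (eD k) := by
    intro k
    rw [hTZ, map_smul, hX, map_smul, hTZ]
    push_cast
    module
  have hZY : ∀ k, TZ (TY (eD k)) - TY (TZ (eD k)) = -TY (eD k) := by
    intro k
    rw [hTZ, map_smul, hY, map_smul, hTZ]
    push_cast
    module
  intro F1 F2 F3
  refine ⟨Dfin_hom_ext_s7 fun k => ?_, Dfin_hom_ext_s7 fun k => ?_, Dfin_hom_ext_s7 fun k => ?_⟩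
  · rw [abs_of_neg hK]
    simp only [F1, F2, F3, LinearMap.sub_apply, LinearMap.add_apply, LinearMap.smul_apply,
      LinearMap.comp_apply, map_smul, map_sub, map_add]
    rw [hTZ, Complex.ofReal_neg]
    linear_combination (norm := module) (-2 * Complex.I) • hXY k
  · simp only [F1, F2, F3, LinearMap.sub_apply, LinearMap.add_apply, LinearMap.smul_apply,
      LinearMap.comp_apply, LinearMap.neg_apply, map_smul, map_sub, smul_sub, smul_smul,
      neg_mul, mul_neg, Complex.I_mul_I, neg_neg, one_smul]
    linear_combination (norm := module) hZY k - hZX k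
  · simp only [F1, F2, F3, LinearMap.sub_apply, LinearMap.add_apply, LinearMap.smul_apply,
      LinearMap.comp_apply, LinearMap.neg_apply, map_smul, map_add]
    linear_combination (norm := module) (-Complex.I) • hZX k - Complex.I • hZY k
end
end

section
/- Set F₁ = T_X + T_Y, F₂ = i·(T_X − T_Y), and F₃ = −i·T_Z as linear operators on D. Then each F_j (j = 1, 2, 3) is skew-symmetric on D: for all v, w ∈ D, ⟪F_j v, w⟫ = −⟪v, F_j w⟫, where ⟪·,·⟫ denotes the Hermitian inner product of ℓ²(ℤ,ℂ). -/
noncomputable section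

lemma Dfin_inner_smul_left (a : ℂ) (v w : Dfin) :
    inner ℂ (a • v) w = starRingEnd ℂ a * inner ℂ v w :=
  inner_smul_left v w a

lemma Dfin_inner_smul_right (a : ℂ) (v w : Dfin) :
    inner ℂ v (a • w) = a * inner ℂ v w :=
  inner_smul_right v w a

lemma inner_eD (k l : ℤ) : inner ℂ (eD k) (eD l) = if k = l then 1 else 0 := by
  rw [Submodule.coe_inner]
  simp only [eD, e]
  rw [lp.inner_single_left, lp.single_apply, Pi.single_apply]
  split_ifs <;> simp

@[elab_as_elim]
lemma Dfin_induction {P : Dfin → Prop} (basis : ∀ k, P (eD k)) (zero : P 0)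
    (add : ∀ x y, P x → P y → P (x + y)) (smul : ∀ (a : ℂ) x, P x → P (a • x))
    (v : Dfin) : P v := by
  obtain ⟨v, hv⟩ := v
  induction hv using Submodule.span_induction with
  | mem x hx =>
    obtain ⟨k, rfl⟩ := hx
    exact basis k
  | zero => exact zero
  | add x y hx hy ihx ihy => exact add ⟨x, hx⟩ ⟨y, hy⟩ ihx ihy
  | smul a x hx ih => exact smul a ⟨x, hx⟩ ih

/-- A skew-adjointness relation on `Dfin` may be checked on the basis vectors. -/
lemma inner_eq_neg_inner_of_eD {A B : Dfin →ₗ[ℂ] Dfin}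
    (h : ∀ k l, inner ℂ (A (eD k)) (eD l) = -inner ℂ (eD k) (B (eD l))) (v w : Dfin) :
    inner ℂ (A v) w = -inner ℂ v (B w) := by
  induction v using Dfin_induction with
  | basis k =>
    induction w using Dfin_induction with
    | basis l => exact h k l
    | zero => simp
    | add x y hx hy => rw [map_add, inner_add_right, inner_add_right, hx, hy, neg_add]
    | smul a x hx => rw [map_smul, Dfin_inner_smul_right, Dfin_inner_smul_right, hx, mul_neg]
  | zero => simp
  | add x y hx hy => rw [map_add, inner_add_left, inner_add_left, hx, hy, neg_add]
  | smul a x hx => rw [map_smul, Dfin_inner_smul_left, Dfin_inner_smul_left, hx, mul_neg]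

/-- A weighted shift with real weights `a k` and the backward shift with weights `-a k` are
skew-adjoint to each other. -/
lemma inner_shift_eq_neg {A B : Dfin →ₗ[ℂ] Dfin}
    (h : ∀ k, ∃ a : ℝ, A (eD k) = (a : ℂ) • eD (k + 1) ∧ B (eD (k + 1)) = (-a : ℂ) • eD k)
    (v w : Dfin) : inner ℂ (A v) w = -inner ℂ v (B w) := by
  choose a hA hB using h
  refine inner_eq_neg_inner_of_eD (fun k l => ?_) v w
  obtain ⟨m, rfl⟩ : ∃ m, l = m + 1 := ⟨l - 1, by ring⟩
  rw [hA, hB, Dfin_inner_smul_left, Dfin_inner_smul_right, inner_eD, inner_eD]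
  by_cases hkm : k = m
  · simp [hkm]
  · simp [hkm]

/-- The operators `F₁ = T_X + T_Y`, `F₂ = i(T_X - T_Y)`, `F₃ = -i T_Z` are skew-symmetric
on `Dfin`: `⟪F_j v, w⟫ = -⟪v, F_j w⟫` for all `v, w ∈ Dfin`. -/
theorem F_skew_symmetric
    (K : ℝ) (hK : K < 0) (c : ℤ → ℝ)
    (hc : ∀ p : ℤ, 1 ≤ p → c p = (1 / 2) * (1 - ((p : ℝ) * ((p : ℝ) - 1) / 2) * K))
    (TX TY TZ : Dfin →ₗ[ℂ] Dfin)
    (hTX_neg : ∀ k : ℤ, k ≤ -2 → TX (eD k) = (-(Real.sqrt (c (-k)) : ℂ)) • eD (k + 1))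
    (hTX_m1 : TX (eD (-1)) = (-((1 / Real.sqrt 2 : ℝ) : ℂ)) • eD 0)
    (hTX_0 : TX (eD 0) = ((1 / Real.sqrt 2 : ℝ) : ℂ) • eD 1)
    (hTX_pos : ∀ k : ℤ, 1 ≤ k → TX (eD k) = ((Real.sqrt (c (k + 1)) : ℝ) : ℂ) • eD (k + 1))
    (hTY_neg : ∀ k : ℤ, k ≤ -1 → TY (eD k) = ((Real.sqrt (c (-k + 1)) : ℝ) : ℂ) • eD (k - 1))
    (hTY_0 : TY (eD 0) = ((1 / Real.sqrt 2 : ℝ) : ℂ) • eD (-1))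
    (hTY_1 : TY (eD 1) = (-((1 / Real.sqrt 2 : ℝ) : ℂ)) • eD 0)
    (hTY_pos : ∀ k : ℤ, 2 ≤ k → TY (eD k) = (-(Real.sqrt (c k) : ℂ)) • eD (k - 1))
    (hTZ : ∀ k : ℤ, TZ (eD k) = (k : ℂ) • eD k)
    :
    let F1 : Dfin →ₗ[ℂ] Dfin := TX + TY
    let F2 : Dfin →ₗ[ℂ] Dfin := Complex.I • (TX - TY)
    let F3 : Dfin →ₗ[ℂ] Dfin := (-Complex.I) • TZ
    ∀ v w : Dfin,
      inner (𝕜 := ℂ) ((F1 v : Dfin) : HS) (w : HS) = -inner (𝕜 := ℂ) (v : HS) ((F1 w : Dfin) : HS) ∧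
      inner (𝕜 := ℂ) ((F2 v : Dfin) : HS) (w : HS) = -inner (𝕜 := ℂ) (v : HS) ((F2 w : Dfin) : HS) ∧
      inner (𝕜 := ℂ) ((F3 v : Dfin) : HS) (w : HS) = -inner (𝕜 := ℂ) (v : HS) ((F3 w : Dfin) : HS) := by
  intro F1 F2 F3 v w
  have hXY : ∀ v w : Dfin, inner ℂ (TX v) w = -inner ℂ v (TY w) := by
    refine inner_shift_eq_neg fun k => ?_
    rcases lt_or_ge k (-1) with hk | hk
    · refine ⟨-Real.sqrt (c (-k)), by rw [hTX_neg k (by lia)]; push_cast; rfl, ?_⟩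
      rw [hTY_neg (k + 1) (by lia), show -(k + 1) + 1 = -k by ring, add_sub_cancel_right]
      simp
    rcases eq_or_lt_of_le hk with rfl | hk
    · exact ⟨-(1 / Real.sqrt 2), by simpa using hTX_m1, by simpa using hTY_0⟩
    rcases eq_or_lt_of_le (show 0 ≤ k by lia) with rfl | hk
    · exact ⟨1 / Real.sqrt 2, by simpa using hTX_0, by simpa using hTY_1⟩
    · refine ⟨Real.sqrt (c (k + 1)), hTX_pos k (by lia), ?_⟩
      rw [hTY_pos (k + 1) (by lia), add_sub_cancel_right]
  have hYX (v w : Dfin) : inner ℂ (TY v) w = -inner ℂ v (TX w) := by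
    rw [← inner_conj_symm (TY v) w, ← inner_conj_symm v (TX w), hXY w v, map_neg, neg_neg]
  have hZ : ∀ v w : Dfin, inner ℂ (TZ v) w = -inner ℂ v ((-TZ) w) := by
    refine inner_eq_neg_inner_of_eD fun k l => ?_
    rw [LinearMap.neg_apply, hTZ, hTZ, inner_neg_right, neg_neg, Dfin_inner_smul_left,
      Dfin_inner_smul_right, inner_eD]
    by_cases hkl : k = l
    · simp [hkl]
    · simp [hkl]
  simp only [← Submodule.coe_inner]
  refine ⟨?_, ?_, ?_⟩
  · simp only [F1, LinearMap.add_apply, inner_add_left, inner_add_right, hXY, hYX]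
    ring
  · simp only [F2, LinearMap.smul_apply, LinearMap.sub_apply, Dfin_inner_smul_left,
      Dfin_inner_smul_right, inner_sub_left, inner_sub_right, hXY, hYX, Complex.conj_I]
    ring
  · simp only [F3, LinearMap.smul_apply, LinearMap.neg_apply, Dfin_inner_smul_left,
      Dfin_inner_smul_right, inner_neg_right, hZ, map_neg, Complex.conj_I]
    ring
end
end

section
/- Let W ⊆ D be a ℂ-linear subspace which is invariant under T_X, T_Y, and T_Z (i.e., T_X(W) ⊆ W, T_Y(W) ⊆ W, T_Z(W) ⊆ W). If W ≠ {0}, then W = D. In other words, the only subspaces of D invariant under all three operators are the zero subspace and D itself. -/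
noncomputable section

theorem span_range_eD : Submodule.span ℂ (Set.range eD) = ⊤ := by
  have h : Set.range eD = Subtype.val ⁻¹' Set.range e := by
    ext ⟨v, hv⟩
    simp [eD]
  rw [h]
  exact Submodule.span_span_coe_preimage

/-- A subspace invariant under an operator contains the components of its vectors along
eigenvectors with pairwise distinct eigenvalues. -/
theorem Submodule.smul_mem_of_sum_eigenvectors_mem {R M ι : Type*} [Field R] [AddCommGroup M]
    [Module R M] {T : M →ₗ[R] M} {W : Submodule R M} (hT : ∀ v ∈ W, T v ∈ W) {b : ι → M}
    {μ : ι → R} (hμ : Function.Injective μ) (hb : ∀ i, T (b i) = μ i • b i) (s : Finset ι)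
    (a : ι → R) (h : ∑ i ∈ s, a i • b i ∈ W) : ∀ i ∈ s, a i • b i ∈ W := by
  classical
  induction s using Finset.induction_on generalizing a with
  | empty => simp
  | insert j s hj ih =>
    have hs : ∀ i ∈ s, a i • b i ∈ W := by
      intro i hi
      have hsub := W.sub_mem (hT _ h) (W.smul_mem (μ j) h)
      have heq : T (∑ i ∈ insert j s, a i • b i) - μ j • ∑ i ∈ insert j s, a i • b i
          = ∑ i ∈ s, ((μ i - μ j) * a i) • b i := by
        rw [map_sum, Finset.smul_sum, ← Finset.sum_sub_distrib, Finset.sum_insert hj]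
        have hterm : ∀ i, T (a i • b i) - μ j • a i • b i = ((μ i - μ j) * a i) • b i := by
          intro i
          rw [map_smul, hb]
          module
        simp only [hterm, sub_self, zero_mul, zero_smul, zero_add]
      rw [heq] at hsub
      have hne : μ i - μ j ≠ 0 := sub_ne_zero.2 fun hij => hj (hμ hij ▸ hi)
      have := ih (fun i => (μ i - μ j) * a i) hsub i hi
      rwa [mul_smul, W.smul_mem_iff hne] at this
    intro i hi
    rcases Finset.mem_insert.1 hi with rfl | hi
    · rw [Finset.sum_insert hj] at h
      exact (W.add_mem_iff_left (W.sum_mem hs)).1 h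
    · exact hs i hi

/-- Irreducibility: every nonzero subspace of `Dfin` invariant under `T_X`, `T_Y`, `T_Z`
is all of `Dfin`. -/
theorem invariant_subspace_trivial
    (K : ℝ) (hK : K < 0) (c : ℤ → ℝ)
    (hc : ∀ p : ℤ, 1 ≤ p → c p = (1 / 2) * (1 - ((p : ℝ) * ((p : ℝ) - 1) / 2) * K))
    (TX TY TZ : Dfin →ₗ[ℂ] Dfin)
    (hTX_neg : ∀ k : ℤ, k ≤ -2 → TX (eD k) = (-(Real.sqrt (c (-k)) : ℂ)) • eD (k + 1))
    (hTX_m1 : TX (eD (-1)) = (-((1 / Real.sqrt 2 : ℝ) : ℂ)) • eD 0)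
    (hTX_0 : TX (eD 0) = ((1 / Real.sqrt 2 : ℝ) : ℂ) • eD 1)
    (hTX_pos : ∀ k : ℤ, 1 ≤ k → TX (eD k) = ((Real.sqrt (c (k + 1)) : ℝ) : ℂ) • eD (k + 1))
    (hTY_neg : ∀ k : ℤ, k ≤ -1 → TY (eD k) = ((Real.sqrt (c (-k + 1)) : ℝ) : ℂ) • eD (k - 1))
    (hTY_0 : TY (eD 0) = ((1 / Real.sqrt 2 : ℝ) : ℂ) • eD (-1))
    (hTY_1 : TY (eD 1) = (-((1 / Real.sqrt 2 : ℝ) : ℂ)) • eD 0)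
    (hTY_pos : ∀ k : ℤ, 2 ≤ k → TY (eD k) = (-(Real.sqrt (c k) : ℂ)) • eD (k - 1))
    (hTZ : ∀ k : ℤ, TZ (eD k) = (k : ℂ) • eD k)
    (W : Submodule ℂ Dfin)
    (hWX : ∀ v : Dfin, v ∈ W → TX v ∈ W)
    (hWY : ∀ v : Dfin, v ∈ W → TY v ∈ W)
    (hWZ : ∀ v : Dfin, v ∈ W → TZ v ∈ W)
    (hW : W ≠ ⊥) :
    W = ⊤ := by
  have hsqrt : ∀ p : ℤ, 1 ≤ p → ((Real.sqrt (c p) : ℝ) : ℂ) ≠ 0 := by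
    intro p hp
    have hp' : (1 : ℝ) ≤ p := by exact_mod_cast hp
    have hpos : 0 < c p := by
      rw [hc p hp]
      nlinarith [mul_nonneg (mul_nonneg (zero_le_one.trans hp') (sub_nonneg.2 hp'))
        (neg_nonneg.2 hK.le)]
    exact_mod_cast (Real.sqrt_pos.2 hpos).ne'
  have htwo : ((1 / Real.sqrt 2 : ℝ) : ℂ) ≠ 0 := by
    have : (0 : ℝ) < 1 / Real.sqrt 2 := by positivity
    exact_mod_cast this.ne'
  have hup : ∀ k : ℤ, eD k ∈ W → eD (k + 1) ∈ W := by
    intro k hk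
    have h := hWX _ hk
    obtain hk2 | rfl | rfl | hk1 : k ≤ -2 ∨ k = -1 ∨ k = 0 ∨ 1 ≤ k := by omega
    · rwa [hTX_neg k hk2, W.smul_mem_iff (neg_ne_zero.2 (hsqrt _ (by omega)))] at h
    · rwa [hTX_m1, W.smul_mem_iff (neg_ne_zero.2 htwo)] at h
    · rwa [hTX_0, W.smul_mem_iff htwo] at h
    · rwa [hTX_pos k hk1, W.smul_mem_iff (hsqrt _ (by omega))] at h
  have hdown : ∀ k : ℤ, eD k ∈ W → eD (k - 1) ∈ W := by
    intro k hk
    have h := hWY _ hk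
    obtain hk2 | rfl | rfl | hk1 : k ≤ -1 ∨ k = 0 ∨ k = 1 ∨ 2 ≤ k := by omega
    · rwa [hTY_neg k hk2, W.smul_mem_iff (hsqrt _ (by omega))] at h
    · rwa [hTY_0, W.smul_mem_iff htwo] at h
    · rwa [hTY_1, W.smul_mem_iff (neg_ne_zero.2 htwo)] at h
    · rwa [hTY_pos k hk1, W.smul_mem_iff (neg_ne_zero.2 (hsqrt _ (by omega)))] at h
  obtain ⟨v, hv, hv0⟩ := W.ne_bot_iff.1 hW
  obtain ⟨a, rfl⟩ := Finsupp.mem_span_range_iff_exists_finsupp.1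
    (span_range_eD ▸ Submodule.mem_top : v ∈ Submodule.span ℂ (Set.range eD))
  obtain ⟨m, hm, -⟩ := Finset.exists_ne_zero_of_sum_ne_zero hv0
  have hmW : eD m ∈ W := (W.smul_mem_iff (Finsupp.mem_support_iff.1 hm)).1
    (Submodule.smul_mem_of_sum_eigenvectors_mem hWZ Int.cast_injective hTZ a.support a hv m hm)
  rw [eq_top_iff, ← span_range_eD, Submodule.span_le]
  rintro _ ⟨k, rfl⟩
  exact Int.inductionOn' k m hmW (fun k _ hk => hup k hk) fun k _ hk => hdown k hk
end
end

section
/- Consider the densely defined unbounded operator i·(T_X + T_Y) on the Hilbert space ℓ²(ℤ,ℂ) with domain D the finitely supported sequences. Then i·(T_X + T_Y) is essentially self-adjoint: it is symmetric on D, it is closable, and its adjoint (as a densely defined operator) equals its closure. -/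
noncomputable section

lemma e_apply (k j : ℤ) : (e k : ∀ _ : ℤ, ℂ) j = if j = k then 1 else 0 := by
  simp [e, Pi.single_apply]

lemma inner_e_left (k : ℤ) (x : HS) : inner ℂ (e k) x = x k := by
  simp [e, lp.inner_single_left]

lemma dense_Dfin : Dense (Dfin : Set HS) := by
  rw [Submodule.dense_iff_topologicalClosure_eq_top, Submodule.topologicalClosure_eq_top_iff,
    Submodule.eq_bot_iff]
  intro x hx
  ext k
  simpa [inner_e_left] using (Submodule.mem_orthogonal _ _).1 hx (e k) (e_mem k)

lemma summable_norm_sq (x : HS) : Summable fun k => ‖x k‖ ^ 2 := by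
  simpa using (lp.memℓp x).summable (by norm_num)

lemma norm_sq_eq_tsum (x : HS) : ‖x‖ ^ 2 = ∑' k, ‖x k‖ ^ 2 := by
  simpa using lp.norm_rpow_eq_tsum (p := 2) (by norm_num) x

/-- Dominated convergence in `ℓ²(ℤ, ℂ)`. -/
lemma tendsto_zero_of_dominated {u : ℕ → HS} {b : ℤ → ℝ} (hb : Summable fun k => b k ^ 2)
    (hub : ∀ n k, ‖u n k‖ ≤ b k) (hu : ∀ k, Filter.Tendsto (fun n => u n k) Filter.atTop (nhds 0)) :
    Filter.Tendsto u Filter.atTop (nhds 0) := by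
  have h : Filter.Tendsto (fun n => ∑' k, ‖u n k‖ ^ 2) Filter.atTop (nhds (∑' _ : ℤ, (0 : ℝ))) := by
    refine tendsto_tsum_of_dominated_convergence hb (fun k => ?_) (.of_forall fun n k => ?_)
    · simpa using (hu k).norm.pow 2
    · rw [Real.norm_of_nonneg (by positivity)]
      exact pow_le_pow_left₀ (norm_nonneg _) (hub n k) 2
  rw [tendsto_zero_iff_norm_tendsto_zero]
  simpa [← norm_sq_eq_tsum, Real.sqrt_sq] using h.sqrt

/-- The tent function of height one supported on `[-(n + 1), n + 1]`. -/
def tent (n : ℕ) (k : ℤ) : ℝ := max 0 (1 - |(k : ℝ)| / (n + 1))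

lemma tent_nonneg (n : ℕ) (k : ℤ) : 0 ≤ tent n k := le_max_left _ _

lemma tent_le_one (n : ℕ) (k : ℤ) : tent n k ≤ 1 :=
  max_le zero_le_one (sub_le_self _ (by positivity))

lemma tent_eq_zero {n : ℕ} {k : ℤ} (h : (n : ℝ) + 1 ≤ |(k : ℝ)|) : tent n k = 0 :=
  max_eq_left (sub_nonpos.2 ((one_le_div (by positivity)).2 h))

lemma tendsto_tent (k : ℤ) : Filter.Tendsto (fun n => tent n k) Filter.atTop (nhds 1) := by
  have h := (tendsto_one_div_add_atTop_nhds_zero_nat (𝕜 := ℝ)).const_mul |(k : ℝ)|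
  have h' := (tendsto_const_nhds (x := (0 : ℝ))).max (h.const_sub 1)
  simpa [tent, div_eq_mul_inv] using h'

lemma abs_tent_succ_sub_le (n : ℕ) (k : ℤ) : |tent n (k + 1) - tent n k| ≤ 1 / (n + 1) := by
  have hk : |(|(k : ℝ)| - |((k + 1 : ℤ) : ℝ)|)| ≤ 1 := by
    refine (abs_abs_sub_abs_le _ _).trans ?_
    simp
  refine (abs_max_sub_max_le_max _ _ _ _).trans (max_le (by simp; positivity) ?_)
  rw [sub_sub_sub_cancel_left, ← sub_div, abs_div, abs_of_pos (by positivity : (0 : ℝ) < n + 1)]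
  gcongr

lemma abs_mul_tent_succ_sub_le {a : ℤ → ℝ} {M : ℝ} (hM : ∀ k : ℤ, |a k| ≤ M * (|(k : ℝ)| + 1))
    (n : ℕ) (k : ℤ) : |a k * (tent n (k + 1) - tent n k)| ≤ 2 * M := by
  have hM0 : 0 ≤ M := by simpa using (abs_nonneg _).trans (hM 0)
  rw [abs_mul]
  rcases le_or_gt |k| (n + 1) with h | h
  · have h' : |(k : ℝ)| ≤ n + 1 := by exact_mod_cast h
    calc |a k| * |tent n (k + 1) - tent n k|
        ≤ (M * (n + 1 + 1)) * (1 / (n + 1)) := by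
          gcongr
          · exact (hM k).trans (by gcongr)
          · exact abs_tent_succ_sub_le n k
      _ ≤ 2 * M := by
          rw [mul_one_div, div_le_iff₀ (by positivity)]
          nlinarith [mul_nonneg hM0 (Nat.cast_nonneg (α := ℝ) n)]
  · have h1 : (n : ℤ) + 1 ≤ |k + 1| := by
      rcases abs_cases k with h' | h' <;> rcases abs_cases (k + 1) with h'' | h'' <;> omega
    rw [tent_eq_zero (k := k + 1) (by exact_mod_cast h1),
      tent_eq_zero (k := k) (by exact_mod_cast h.le)]
    simpa using hM0

/-- The truncation of `x` by the tent function. -/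
def truncate (n : ℕ) (x : HS) : HS :=
  ∑ k ∈ Finset.Icc (-(n : ℤ)) n, ((tent n k : ℂ) * x k) • e k

lemma truncate_mem (n : ℕ) (x : HS) : truncate n x ∈ Dfin :=
  Submodule.sum_mem _ fun k _ => Submodule.smul_mem _ _ (e_mem k)

lemma truncate_apply (n : ℕ) (x : HS) (k : ℤ) : truncate n x k = tent n k * x k := by
  have h : truncate n x k =
      ∑ j ∈ Finset.Icc (-(n : ℤ)) n, ((tent n j : ℂ) * x j) * (if k = j then 1 else 0) := by
    rw [← inner_e_left, truncate, inner_sum]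
    simp only [inner_smul_right, inner_e_left, e_apply]
  rw [h]
  simp only [mul_ite, mul_one, mul_zero, Finset.sum_ite_eq, ite_eq_left_iff]
  intro hk
  rw [tent_eq_zero]
  · simp
  · have : (n : ℤ) + 1 ≤ |k| := by
      rw [Finset.mem_Icc] at hk
      rcases abs_cases k with h | h <;> omega
    exact_mod_cast this

lemma tendsto_truncate (x : HS) :
    Filter.Tendsto (fun n => truncate n x) Filter.atTop (nhds x) := by
  rw [tendsto_iff_norm_sub_tendsto_zero, ← tendsto_zero_iff_norm_tendsto_zero]
  have hx (n : ℕ) (k : ℤ) : (truncate n x - x) k = ((tent n k - 1 : ℝ) : ℂ) * x k := by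
    rw [lp.coeFn_sub, Pi.sub_apply, truncate_apply]
    push_cast
    ring
  refine tendsto_zero_of_dominated (summable_norm_sq x) (fun n k => ?_) fun k => ?_
  · rw [hx, norm_mul, Complex.norm_real, Real.norm_eq_abs]
    refine mul_le_of_le_one_left (norm_nonneg _) (abs_le.2 ⟨?_, ?_⟩) <;>
      linarith [tent_nonneg n k, tent_le_one n k]
  · simp only [hx]
    have := (Complex.continuous_ofReal.tendsto _).comp ((tendsto_tent k).sub_const 1)
    simpa using this.mul_const (x k)

/-- A symmetric Jacobi operator on `ℓ²(ℤ, ℂ)` with zero diagonal and purely imaginary off-diagonal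
entries. -/
def IsJacobi (S : HS →ₗ.[ℂ] HS) (a : ℤ → ℝ) : Prop :=
  S.domain = Dfin ∧ ∀ (k : ℤ) (h : e k ∈ S.domain),
    S ⟨e k, h⟩ = Complex.I • ((a k : ℂ) • e (k + 1) - (a (k - 1) : ℂ) • e (k - 1))

namespace IsJacobi

variable {S : HS →ₗ.[ℂ] HS} {a : ℤ → ℝ}

lemma dense_domain (h : IsJacobi S a) : Dense (S.domain : Set HS) := by
  rw [h.1]
  exact dense_Dfin

lemma inner_apply_e (h : IsJacobi S a) (x : HS) (k : ℤ) (hk : e k ∈ S.domain) :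
    inner ℂ (S ⟨e k, hk⟩) x = Complex.I * (a (k - 1) * x (k - 1) - a k * x (k + 1)) := by
  rw [h.2, inner_smul_left, inner_sub_left, inner_smul_left, inner_smul_left, inner_e_left,
    inner_e_left, Complex.conj_I, Complex.conj_ofReal, Complex.conj_ofReal]
  ring

lemma apply_coord (h : IsJacobi S a) (x : S.domain) (k : ℤ) :
    S x k = Complex.I * (a (k - 1) * (x : HS) (k - 1) - a k * (x : HS) (k + 1)) := by
  obtain ⟨x, hx⟩ := x
  have hx' : x ∈ Dfin := h.1 ▸ hx
  induction hx' using Submodule.span_induction with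
  | mem x hx' =>
    obtain ⟨j, rfl⟩ := hx'
    rw [h.2]
    have h1 : (k = j + 1) ↔ (k - 1 = j) := by omega
    have h2 : (k = j - 1) ↔ (k + 1 = j) := by omega
    simp only [lp.coeFn_smul, lp.coeFn_sub, Pi.smul_apply, Pi.sub_apply, e_apply, smul_eq_mul, h1,
      h2]
    by_cases h3 : k - 1 = j <;> by_cases h4 : k + 1 = j
    · omega
    · subst h3
      simp [h4]
    · subst h4
      simp [h3]
    · simp [h3, h4]
  | zero =>
    have : S ⟨0, hx⟩ = 0 := S.map_zero
    rw [this]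
    simp
  | add x y hx1 hy1 ihx ihy =>
    have hx2 : x ∈ S.domain := by rw [h.1]; exact hx1
    have hy2 : y ∈ S.domain := by rw [h.1]; exact hy1
    have : S ⟨x + y, hx⟩ = S ⟨x, hx2⟩ + S ⟨y, hy2⟩ := S.map_add ⟨x, hx2⟩ ⟨y, hy2⟩
    rw [this, lp.coeFn_add, Pi.add_apply, ihx hx2, ihy hy2]
    simp only [lp.coeFn_add, Pi.add_apply]
    ring
  | smul c x hx1 ihx =>
    have hx2 : x ∈ S.domain := by rw [h.1]; exact hx1
    have : S ⟨c • x, hx⟩ = c • S ⟨x, hx2⟩ := S.map_smul c ⟨x, hx2⟩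
    rw [this, lp.coeFn_smul, Pi.smul_apply, ihx hx2]
    simp only [lp.coeFn_smul, Pi.smul_apply, smul_eq_mul]
    ring

lemma mem_domain (h : IsJacobi S a) (k : ℤ) : e k ∈ S.domain := by
  rw [h.1]
  exact e_mem k

lemma isFormalAdjoint (h : IsJacobi S a) : S.IsFormalAdjoint S := by
  rintro ⟨x, hx⟩ w
  have hx' : x ∈ Dfin := h.1 ▸ hx
  induction hx' using Submodule.span_induction with
  | mem x hx' =>
    obtain ⟨j, rfl⟩ := hx'
    rw [h.inner_apply_e, inner_e_left, h.apply_coord]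
  | zero =>
    have : S ⟨0, hx⟩ = 0 := S.map_zero
    rw [this]
    simp
  | add x y hx1 hy1 ihx ihy =>
    have hx2 : x ∈ S.domain := by rw [h.1]; exact hx1
    have hy2 : y ∈ S.domain := by rw [h.1]; exact hy1
    have : S ⟨x + y, hx⟩ = S ⟨x, hx2⟩ + S ⟨y, hy2⟩ := S.map_add ⟨x, hx2⟩ ⟨y, hy2⟩
    rw [this, inner_add_left, inner_add_left, ihx hx2, ihy hy2]
  | smul c x hx1 ihx =>
    have hx2 : x ∈ S.domain := by rw [h.1]; exact hx1
    have : S ⟨c • x, hx⟩ = c • S ⟨x, hx2⟩ := S.map_smul c ⟨x, hx2⟩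
    rw [this, inner_smul_left, inner_smul_left, ihx hx2]

lemma le_adjoint (h : IsJacobi S a) : S ≤ S.adjoint :=
  h.isFormalAdjoint.le_adjoint h.dense_domain

lemma isClosable (h : IsJacobi S a) : S.IsClosable :=
  (LinearPMap.adjoint_isClosed h.dense_domain).isClosable.leIsClosable h.le_adjoint

lemma adjoint_apply_coord (h : IsJacobi S a) (y : S.adjoint.domain) (k : ℤ) :
    S.adjoint y k = Complex.I * (a (k - 1) * (y : HS) (k - 1) - a k * (y : HS) (k + 1)) := by
  rw [← inner_e_left, ← h.inner_apply_e _ k (h.mem_domain k)]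
  exact ((LinearPMap.adjoint_isFormalAdjoint h.dense_domain).symm ⟨e k, h.mem_domain k⟩ y).symm

lemma truncate_mem_domain (h : IsJacobi S a) (n : ℕ) (x : HS) : truncate n x ∈ S.domain := by
  rw [h.1]
  exact truncate_mem n x

lemma tendsto_apply_truncate (h : IsJacobi S a) {M : ℝ}
    (hM : ∀ k : ℤ, |a k| ≤ M * (|(k : ℝ)| + 1)) (y : S.adjoint.domain) :
    Filter.Tendsto (fun n => S ⟨truncate n y, h.truncate_mem_domain n y⟩) Filter.atTop
      (nhds (S.adjoint y)) := by
  set z := S.adjoint y with hz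
  rw [tendsto_iff_norm_sub_tendsto_zero, ← tendsto_zero_iff_norm_tendsto_zero]
  have hM0 : 0 ≤ M := by simpa using (abs_nonneg _).trans (hM 0)
  have hsum : Summable fun k : ℤ =>
      (2 * M * ‖(y : HS) (k - 1)‖ + 2 * M * ‖(y : HS) (k + 1)‖ + ‖z k‖) ^ 2 := by
    have h1 := (Equiv.subRight (1 : ℤ)).summable_iff.2 (summable_norm_sq (y : HS))
    have h2 := (Equiv.addRight (1 : ℤ)).summable_iff.2 (summable_norm_sq (y : HS))
    refine Summable.of_nonneg_of_le (fun k => sq_nonneg _) (fun k => ?_)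
      ((((h1.mul_left (4 * M ^ 2)).add (h2.mul_left (4 * M ^ 2))).add
        (summable_norm_sq z)).mul_left 3)
    simp only [Function.comp_apply, Equiv.subRight_apply, Equiv.coe_addRight]
    nlinarith [sq_nonneg (2 * M * ‖(y : HS) (k - 1)‖ - 2 * M * ‖(y : HS) (k + 1)‖),
      sq_nonneg (2 * M * ‖(y : HS) (k - 1)‖ - ‖z k‖),
      sq_nonneg (2 * M * ‖(y : HS) (k + 1)‖ - ‖z k‖)]
  have hcoord (n : ℕ) (k : ℤ) : (S ⟨truncate n y, h.truncate_mem_domain n y⟩ - z) k =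
      Complex.I * (a (k - 1) * (tent n (k - 1) * (y : HS) (k - 1)) -
        a k * (tent n (k + 1) * (y : HS) (k + 1))) - z k := by
    rw [lp.coeFn_sub, Pi.sub_apply, h.apply_coord]
    simp only [truncate_apply]
  refine tendsto_zero_of_dominated hsum (fun n k => ?_) fun k => ?_
  · have hsplit : (S ⟨truncate n y, h.truncate_mem_domain n y⟩ - z) k =
        -(Complex.I * ((a (k - 1) * (tent n (k - 1 + 1) - tent n (k - 1)) : ℝ) *
          (y : HS) (k - 1))) - Complex.I * ((a k * (tent n (k + 1) - tent n k) : ℝ) *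
          (y : HS) (k + 1)) + (tent n k - 1 : ℝ) * z k := by
      rw [hcoord, hz, h.adjoint_apply_coord, sub_add_cancel]
      push_cast
      ring
    rw [hsplit]
    refine (norm_add_le _ _).trans (add_le_add ((norm_sub_le _ _).trans (add_le_add ?_ ?_)) ?_)
    · rw [norm_neg, norm_mul, norm_mul, Complex.norm_I, one_mul, Complex.norm_real]
      gcongr
      exact abs_mul_tent_succ_sub_le hM n (k - 1)
    · rw [norm_mul, norm_mul, Complex.norm_I, one_mul, Complex.norm_real]
      gcongr
      exact abs_mul_tent_succ_sub_le hM n k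
    · rw [norm_mul, Complex.norm_real, Real.norm_eq_abs]
      refine mul_le_of_le_one_left (norm_nonneg _) (abs_le.2 ⟨?_, ?_⟩) <;>
        linarith [tent_nonneg n k, tent_le_one n k]
  · simp only [hcoord]
    have ht (j : ℤ) := ((Complex.continuous_ofReal.tendsto _).comp (tendsto_tent j)).mul_const
      ((y : HS) j)
    have := ((((ht (k - 1)).const_mul (a (k - 1) : ℂ)).sub
      ((ht (k + 1)).const_mul (a k : ℂ))).const_mul Complex.I).sub_const (z k)
    simpa [hz, h.adjoint_apply_coord] using this

/-- A Jacobi operator whose off-diagonal entries grow at most linearly is essentially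
self-adjoint. -/
lemma adjoint_eq_closure (h : IsJacobi S a) {M : ℝ}
    (hM : ∀ k : ℤ, |a k| ≤ M * (|(k : ℝ)| + 1)) : S.adjoint = S.closure := by
  apply LinearPMap.eq_of_eq_graph
  rw [← h.isClosable.graph_closure_eq_closure_graph]
  apply le_antisymm
  · rintro ⟨y, z⟩ hyz
    obtain ⟨y, rfl, rfl⟩ := (LinearPMap.mem_graph_iff _).1 hyz
    refine mem_closure_of_tendsto ((tendsto_truncate y).prodMk_nhds (h.tendsto_apply_truncate hM y))
      (.of_forall fun n => ?_)
    exact S.mem_graph ⟨truncate n y, h.truncate_mem_domain n y⟩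
  · exact Submodule.topologicalClosure_minimal _ (LinearPMap.le_graph_of_le h.le_adjoint)
      (LinearPMap.adjoint_isClosed h.dense_domain)

end IsJacobi

/-- The densely defined operator `i(T_X + T_Y)` on `ℓ²(ℤ,ℂ)` with domain the finitely
supported sequences is essentially self-adjoint: it is symmetric on its domain, closable,
and its adjoint equals its closure. -/
theorem F1_essentially_self_adjoint
    (K : ℝ) (hK : K < 0) (c : ℤ → ℝ)
    (hc : ∀ p : ℤ, 1 ≤ p → c p = (1 / 2) * (1 - ((p : ℝ) * ((p : ℝ) - 1) / 2) * K))
    (TX TY TZ : Dfin →ₗ[ℂ] Dfin)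
    (hTX_neg : ∀ k : ℤ, k ≤ -2 → TX (eD k) = (-(Real.sqrt (c (-k)) : ℂ)) • eD (k + 1))
    (hTX_m1 : TX (eD (-1)) = (-((1 / Real.sqrt 2 : ℝ) : ℂ)) • eD 0)
    (hTX_0 : TX (eD 0) = ((1 / Real.sqrt 2 : ℝ) : ℂ) • eD 1)
    (hTX_pos : ∀ k : ℤ, 1 ≤ k → TX (eD k) = ((Real.sqrt (c (k + 1)) : ℝ) : ℂ) • eD (k + 1))
    (hTY_neg : ∀ k : ℤ, k ≤ -1 → TY (eD k) = ((Real.sqrt (c (-k + 1)) : ℝ) : ℂ) • eD (k - 1))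
    (hTY_0 : TY (eD 0) = ((1 / Real.sqrt 2 : ℝ) : ℂ) • eD (-1))
    (hTY_1 : TY (eD 1) = (-((1 / Real.sqrt 2 : ℝ) : ℂ)) • eD 0)
    (hTY_pos : ∀ k : ℤ, 2 ≤ k → TY (eD k) = (-(Real.sqrt (c k) : ℂ)) • eD (k - 1))
    (hTZ : ∀ k : ℤ, TZ (eD k) = (k : ℂ) • eD k)
    (S : HS →ₗ.[ℂ] HS) (hdom : S.domain = Dfin)
    (hS : ∀ (x : HS) (hx : x ∈ Dfin) (hx' : x ∈ S.domain),
      S ⟨x, hx'⟩ = Complex.I • (((TX ⟨x, hx⟩ : Dfin) : HS) + ((TY ⟨x, hx⟩ : Dfin) : HS))) :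
    (∀ v w : S.domain, inner (𝕜 := ℂ) (S v) (w : HS) = inner (𝕜 := ℂ) (v : HS) (S w)) ∧
    S.IsClosable ∧ S.adjoint = S.closure := by
  set a : ℤ → ℝ := fun k => if 0 ≤ k then √(c (k + 1)) else -√(c (-k)) with ha
  have hc1 : √(c 1) = 1 / √2 := by
    rw [hc 1 le_rfl]
    norm_num
  have hTX (k : ℤ) : TX (eD k) = (a k : ℂ) • eD (k + 1) := by
    rcases (by omega : k ≤ -2 ∨ k = -1 ∨ k = 0 ∨ 1 ≤ k) with h | rfl | rfl | h
    · rw [hTX_neg k h, ha]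
      simp [show ¬ 0 ≤ k by omega]
    · rw [hTX_m1]
      simp [ha, hc1]
    · rw [hTX_0]
      simp [ha, hc1]
    · rw [hTX_pos k h, ha]
      simp [show 0 ≤ k by omega]
  have hTY (k : ℤ) : TY (eD k) = -((a (k - 1) : ℂ) • eD (k - 1)) := by
    rcases (by omega : k ≤ -1 ∨ k = 0 ∨ k = 1 ∨ 2 ≤ k) with h | rfl | rfl | h
    · rw [hTY_neg k h, ha]
      simp [show ¬ 1 ≤ k by omega, show -k + 1 = 1 - k by ring]
    · rw [hTY_0]
      simp [ha, hc1]
    · rw [hTY_1]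
      simp [ha, hc1]
    · rw [hTY_pos k h, ha]
      simp [show 1 ≤ k by omega]
  have hJ : IsJacobi S a := by
    refine ⟨hdom, fun k hk => ?_⟩
    rw [hS (e k) (e_mem k) hk, show (⟨e k, e_mem k⟩ : Dfin) = eD k from rfl, hTX, hTY,
      sub_eq_add_neg]
    rfl
  have hsqrt (p : ℤ) (hp : 1 ≤ p) : √(c p) ≤ (1 - K) * p := by
    have hp' : (1 : ℝ) ≤ p := by exact_mod_cast hp
    refine Real.sqrt_le_iff.2 ⟨by nlinarith, ?_⟩
    rw [hc p hp]
    nlinarith [mul_nonneg (neg_nonneg.2 hK.le) (by nlinarith : (0 : ℝ) ≤ (p : ℝ) ^ 2),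
      mul_nonneg (neg_nonneg.2 hK.le) (by linarith : (0 : ℝ) ≤ p), sq_nonneg (K * p)]
  have hM (k : ℤ) : |a k| ≤ (1 - K) * (|(k : ℝ)| + 1) := by
    by_cases hk : 0 ≤ k
    · have hk' : (0 : ℝ) ≤ k := by exact_mod_cast hk
      have := hsqrt (k + 1) (by omega)
      push_cast at this
      simpa [ha, hk, abs_of_nonneg hk', abs_of_nonneg (Real.sqrt_nonneg _)] using this
    · have hk' : (k : ℝ) < 0 := by exact_mod_cast not_le.1 hk
      have := hsqrt (-k) (by omega)
      push_cast at this
      simp only [ha, hk, if_false, abs_neg, abs_of_nonneg (Real.sqrt_nonneg _), abs_of_neg hk']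
      linarith
  exact ⟨hJ.isFormalAdjoint, hJ.isClosable, hJ.adjoint_eq_closure hM⟩
end
end

section
/- Let H be a separable real Hilbert space, let p ∈ ℝ², let R > 0, and let u : ℝ² → H be a map which is smooth (infinitely Fréchet differentiable) on the open ball B(p, R) and satisfies Δu = −2u on B(p, R), where Δu(x) = D²u(x)(ξ₁,ξ₁) + D²u(x)(ξ₂,ξ₂) is the Laplacian computed from the second Fréchet derivative of u and the standard orthonormal basis ξ₁, ξ₂ of ℝ². Then for every r ∈ (0, R) there exist constants M, C > 0 (independent of the order of differentiation) such that for every n ∈ ℕ and every x ∈ B(p, r), the operator norm of the n-th iterated Fréchet derivative of u satisfies ‖D^n u(x)‖ ≤ n!·M·C^n·(R − r)^{−n}. -/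
open Metric

theorem nonpos_of_isLocalMax_of_hasDerivAt {f f' : ℝ → ℝ} {t s : ℝ}
    (hf : ∀ᶠ x in nhds t, HasDerivAt f (f' x) x) (hf' : HasDerivAt f' s t)
    (hmax : IsLocalMax f t) : s ≤ 0 := by
  by_contra! hs
  have hd : deriv f =ᶠ[nhds t] f' := hf.mono fun x hx => hx.deriv
  have hdd : deriv (deriv f) t = s := hd.deriv_eq.trans hf'.deriv
  have hmin : IsLocalMin f t :=
    isLocalMin_of_deriv_deriv_pos (by rw [hdd]; exact hs) hmax.deriv_eq_zero
      hf.self_of_nhds.continuousAt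
  have hconst : f =ᶠ[nhds t] fun _ => f t := by
    filter_upwards [hmin, hmax] with x h₁ h₂ using le_antisymm h₂ h₁
  have h0 : deriv (deriv f) t = 0 := by
    rw [hconst.deriv.deriv_eq]; simp
  linarith

theorem second_deriv_auxiliary_nonpos {H : Type*} [NormedAddCommGroup H] [InnerProductSpace ℝ H]
    {a a' b b' : ℝ → H} {a'' b'' : H} {c q s l k : ℝ}
    (ha : ∀ᶠ t in nhds 0, HasDerivAt a (a' t) t) (ha' : HasDerivAt a' a'' 0)
    (hb : ∀ᶠ t in nhds 0, HasDerivAt b (b' t) t) (hb' : HasDerivAt b' b'' 0)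
    (hmax : IsLocalMax (fun t => (s - (q + 2 * c * t + t ^ 2)) ^ 2 * inner ℝ (a t) (a t)
      + l * inner ℝ (b t) (b t) + k * (q + 2 * c * t + t ^ 2)) 0) :
    8 * c ^ 2 * inner ℝ (a 0) (a 0) - 4 * (s - q) * inner ℝ (a 0) (a 0)
      - 16 * (s - q) * c * inner ℝ (a 0) (a' 0)
      + 2 * (s - q) ^ 2 * (inner ℝ (a' 0) (a' 0) + inner ℝ (a 0) a'')
      + 2 * l * (inner ℝ (b' 0) (b' 0) + inner ℝ (b 0) b'') + 2 * k ≤ 0 := by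
  have hQ : ∀ t, HasDerivAt (fun t : ℝ => q + 2 * c * t + t ^ 2) (2 * c + 2 * t) t := by
    intro t
    have := (((hasDerivAt_id t).const_mul (2 * c)).const_add q).add ((hasDerivAt_id t).pow 2)
    refine this.congr_deriv ?_
    simp
  have hQ' : HasDerivAt (fun t : ℝ => 2 * c + 2 * t) 2 0 := by
    simpa using ((hasDerivAt_id (0 : ℝ)).const_mul 2).const_add (2 * c)
  refine nonpos_of_isLocalMax_of_hasDerivAt (t := 0)
    (f' := fun t => 2 * (s - (q + 2 * c * t + t ^ 2)) * (-(2 * c + 2 * t)) * inner ℝ (a t) (a t)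
      + (s - (q + 2 * c * t + t ^ 2)) ^ 2 * (2 * inner ℝ (a t) (a' t))
      + l * (2 * inner ℝ (b t) (b' t)) + k * (2 * c + 2 * t)) ?_ ?_ hmax
  · filter_upwards [ha, hb] with t hat hbt
    have := (((((hQ t).const_sub s).pow 2).mul (hat.inner ℝ hat)).add
      ((hbt.inner ℝ hbt).const_mul l)).add ((hQ t).const_mul k)
    refine this.congr_deriv ?_
    simp only [real_inner_comm (a t) (a' t), real_inner_comm (b t) (b' t)]
    simp
    ring
  · have hat := ha.self_of_nhds
    have hbt := hb.self_of_nhds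
    have hη := (hQ 0).const_sub s
    have := ((((hη.const_mul 2).mul hQ'.neg).mul (hat.inner ℝ hat)).add
      ((hη.pow 2).mul ((hat.inner ℝ ha').const_mul 2))).add
      (((hbt.inner ℝ hb').const_mul 2).const_mul l) |>.add (hQ'.const_mul k)
    refine this.congr_deriv ?_
    simp only [real_inner_comm (a 0) (a' 0)]
    simp
    ring

/-- The smooth solutions of `Δv = -2v` on a set, with the Laplacian written through iterated
directional derivatives along the standard basis of the plane. -/
structure IsEigenOn {H : Type*} [NormedAddCommGroup H] [InnerProductSpace ℝ H]
    (v : EuclideanSpace ℝ (Fin 2) → H) (B : Set (EuclideanSpace ℝ (Fin 2))) : Prop where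
  contDiffOn : ContDiffOn ℝ (⊤ : ℕ∞) v B
  laplace : ∀ x ∈ B, ∑ i, fderiv ℝ (fun y => fderiv ℝ v y (EuclideanSpace.single i 1)) x
    (EuclideanSpace.single i 1) = (-2 : ℝ) • v x

section

variable {H : Type*} [NormedAddCommGroup H] [InnerProductSpace ℝ H]
  {v : EuclideanSpace ℝ (Fin 2) → H} {B : Set (EuclideanSpace ℝ (Fin 2))}

theorem contDiffOn_fderiv_apply (hv : ContDiffOn ℝ (⊤ : ℕ∞) v B) (hB : IsOpen B)
    (e : EuclideanSpace ℝ (Fin 2)) : ContDiffOn ℝ (⊤ : ℕ∞) (fun y => fderiv ℝ v y e) B :=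
  (hv.fderiv_of_isOpen hB (by simp)).clm_apply contDiffOn_const

theorem fderiv_fderiv_apply_comm (hv : ContDiffOn ℝ (⊤ : ℕ∞) v B) (hB : IsOpen B)
    (e f : EuclideanSpace ℝ (Fin 2)) {x : EuclideanSpace ℝ (Fin 2)} (hx : x ∈ B) :
    fderiv ℝ (fun y => fderiv ℝ v y e) x f = fderiv ℝ (fun y => fderiv ℝ v y f) x e := by
  have hd : DifferentiableAt ℝ (fderiv ℝ v) x :=
    ((hv.fderiv_of_isOpen (m := 1) hB (by norm_cast)).contDiffAt
      (hB.mem_nhds hx)).differentiableAt (by simp)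
  have hs : IsSymmSndFDerivAt ℝ v x :=
    (hv.contDiffAt (hB.mem_nhds hx)).isSymmSndFDerivAt
      (by simp only [minSmoothness_of_isRCLikeNormedField]; exact ENat.LEInfty.out)
  rw [fderiv_clm_apply hd (differentiableAt_const _), fderiv_clm_apply hd (differentiableAt_const _)]
  simpa using hs f e

theorem IsEigenOn.fderiv_apply (hv : IsEigenOn v B) (hB : IsOpen B)
    (e : EuclideanSpace ℝ (Fin 2)) : IsEigenOn (fun y => fderiv ℝ v y e) B := by
  refine ⟨contDiffOn_fderiv_apply hv.contDiffOn hB e, fun x hx => ?_⟩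
  have hsm := fun f => contDiffOn_fderiv_apply hv.contDiffOn hB f
  have hcomm : ∀ f, fderiv ℝ (fun y => fderiv ℝ (fun z => fderiv ℝ v z e) y f) x f =
      fderiv ℝ (fun y => fderiv ℝ (fun z => fderiv ℝ v z f) y f) x e := by
    intro f
    have : (fun y => fderiv ℝ (fun z => fderiv ℝ v z e) y f) =ᶠ[nhds x]
        fun y => fderiv ℝ (fun z => fderiv ℝ v z f) y e := by
      filter_upwards [hB.mem_nhds hx] with y hy
      exact fderiv_fderiv_apply_comm hv.contDiffOn hB e f hy
    rw [this.fderiv_eq, fderiv_fderiv_apply_comm (hsm f) hB e f hx]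
  have heq : (fun y => ∑ i, fderiv ℝ (fun z => fderiv ℝ v z (EuclideanSpace.single i 1)) y
      (EuclideanSpace.single i 1)) =ᶠ[nhds x] fun y => (-2 : ℝ) • v y := by
    filter_upwards [hB.mem_nhds hx] with y hy using hv.laplace y hy
  have hdiff : ∀ f g, DifferentiableAt ℝ
      (fun y => fderiv ℝ (fun z => fderiv ℝ v z f) y g) x := fun f g =>
    ((contDiffOn_fderiv_apply (hsm f) hB g).contDiffAt (hB.mem_nhds hx)).differentiableAt
      (by simp)
  have hvd : DifferentiableAt ℝ v x :=
    (hv.contDiffOn.contDiffAt (hB.mem_nhds hx)).differentiableAt (by simp)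
  have := congrArg (fun L : EuclideanSpace ℝ (Fin 2) →L[ℝ] H => L e) heq.fderiv_eq
  simp only [hcomm]
  rw [fderiv_fun_sum (fun i _ => hdiff _ _), fderiv_fun_const_smul hvd (-2 : ℝ)] at this
  simpa using this

theorem norm_fderiv_apply_sq_le (x e : EuclideanSpace ℝ (Fin 2)) (he : ‖e‖ ≤ 1) :
    ‖fderiv ℝ v x e‖ ^ 2 ≤ ∑ i, ‖fderiv ℝ v x (EuclideanSpace.single i 1)‖ ^ 2 := by
  have h : e = e 0 • EuclideanSpace.single 0 1 + e 1 • EuclideanSpace.single 1 1 := by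
    ext i; fin_cases i <;> simp
  have hn : e 0 ^ 2 + e 1 ^ 2 ≤ 1 := by
    have := EuclideanSpace.real_norm_sq_eq e
    rw [Fin.sum_univ_two] at this
    nlinarith [norm_nonneg e]
  set a := fderiv ℝ v x (EuclideanSpace.single 0 1)
  set b := fderiv ℝ v x (EuclideanSpace.single 1 1)
  have hle : ‖fderiv ℝ v x e‖ ≤ |e 0| * ‖a‖ + |e 1| * ‖b‖ := by
    conv_lhs => rw [h]
    rw [map_add, map_smul, map_smul]
    exact (norm_add_le _ _).trans (by simp [norm_smul, a, b])
  rw [Fin.sum_univ_two]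
  calc ‖fderiv ℝ v x e‖ ^ 2 ≤ (|e 0| * ‖a‖ + |e 1| * ‖b‖) ^ 2 := by gcongr
    _ ≤ (|e 0| ^ 2 + |e 1| ^ 2) * (‖a‖ ^ 2 + ‖b‖ ^ 2) := by
      nlinarith [sq_nonneg (|e 0| * ‖b‖ - |e 1| * ‖a‖)]
    _ ≤ 1 * (‖a‖ ^ 2 + ‖b‖ ^ 2) := by
      gcongr; simpa using hn
    _ = _ := one_mul _

/-- The sum of the two second-order conditions at an interior maximum of the Bernstein auxiliary
function cannot be nonpositive. -/
theorem bernstein_sum_pos {a a₁ a₂ a₁₁ a₂₂ b b₁ b₂ b₁₁ b₂₂ : H} {c₁ c₂ q ρ m : ℝ}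
    (hρ : 0 < ρ) (hρ1 : ρ ≤ 1) (hm : 0 < m) (hq : q = c₁ ^ 2 + c₂ ^ 2) (hqρ : q < ρ ^ 2)
    (ha : a₁₁ + a₂₂ = (-2 : ℝ) • a) (hb : b₁₁ + b₂₂ = (-2 : ℝ) • b)
    (hab : ‖a‖ ^ 2 ≤ ‖b₁‖ ^ 2 + ‖b₂‖ ^ 2) (hbm : ‖b‖ ≤ m)
    (h₁ : 8 * c₁ ^ 2 * inner ℝ a a - 4 * (ρ ^ 2 - q) * inner ℝ a a
      - 16 * (ρ ^ 2 - q) * c₁ * inner ℝ a a₁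
      + 2 * (ρ ^ 2 - q) ^ 2 * (inner ℝ a₁ a₁ + inner ℝ a a₁₁)
      + 2 * (18 * ρ ^ 2) * (inner ℝ b₁ b₁ + inner ℝ b b₁₁) + 2 * (36 * ρ ^ 2 * m ^ 2) ≤ 0)
    (h₂ : 8 * c₂ ^ 2 * inner ℝ a a - 4 * (ρ ^ 2 - q) * inner ℝ a a
      - 16 * (ρ ^ 2 - q) * c₂ * inner ℝ a a₂
      + 2 * (ρ ^ 2 - q) ^ 2 * (inner ℝ a₂ a₂ + inner ℝ a a₂₂)
      + 2 * (18 * ρ ^ 2) * (inner ℝ b₂ b₂ + inner ℝ b b₂₂) + 2 * (36 * ρ ^ 2 * m ^ 2) ≤ 0) :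
    False := by
  have hA : inner ℝ a a₁₁ + inner ℝ a a₂₂ = -2 * ‖a‖ ^ 2 := by
    rw [← inner_add_right, ha, inner_smul_right, real_inner_self_eq_norm_sq]
  have hBB : inner ℝ b b₁₁ + inner ℝ b b₂₂ = -2 * ‖b‖ ^ 2 := by
    rw [← inner_add_right, hb, inner_smul_right, real_inner_self_eq_norm_sq]
  have hsq : ∀ (c : ℝ) (d : H), 0 ≤ (ρ ^ 2 - q) ^ 2 * ‖d‖ ^ 2
      - 8 * (ρ ^ 2 - q) * c * inner ℝ a d + 16 * c ^ 2 * ‖a‖ ^ 2 := by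
    intro c d
    have := sq_nonneg ‖(ρ ^ 2 - q) • d - (4 * c) • a‖
    rw [norm_sub_sq_real, norm_smul, norm_smul, inner_smul_left, inner_smul_right, mul_pow,
      mul_pow, Real.norm_eq_abs, Real.norm_eq_abs, sq_abs, sq_abs, real_inner_comm] at this
    simp only [conj_trivial] at this
    linarith
  have e₁ := hsq c₁ a₁
  have e₂ := hsq c₂ a₂
  simp only [real_inner_self_eq_norm_sq] at h₁ h₂
  have hρ2 : ρ ^ 2 ≤ 1 := by nlinarith
  have hq0 : 0 ≤ q := by rw [hq]; positivity
  have hη : (ρ ^ 2 - q) ^ 2 ≤ ρ ^ 2 := by nlinarith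
  have hbm2 : ‖b‖ ^ 2 ≤ m ^ 2 := by gcongr
  have f₁ : 0 ≤ ‖a‖ ^ 2 * (ρ ^ 2 - (ρ ^ 2 - q) ^ 2) := mul_nonneg (by positivity) (by linarith)
  have f₂ : 0 ≤ ‖a‖ ^ 2 * (ρ ^ 2 - q) := mul_nonneg (by positivity) (by linarith)
  have f₃ : 0 ≤ ‖a‖ ^ 2 * q := mul_nonneg (by positivity) hq0
  have f₄ : 0 ≤ ρ ^ 2 * (‖b₁‖ ^ 2 + ‖b₂‖ ^ 2 - ‖a‖ ^ 2) :=
    mul_nonneg (by positivity) (by linarith)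
  have f₅ : 0 ≤ ρ ^ 2 * (m ^ 2 - ‖b‖ ^ 2) := mul_nonneg (by positivity) (by linarith)
  have f₆ : 0 < ρ ^ 2 * m ^ 2 := by positivity
  have hAη : (ρ ^ 2 - q) ^ 2 * (inner ℝ a a₁₁ + inner ℝ a a₂₂) =
    (ρ ^ 2 - q) ^ 2 * (-2 * ‖a‖ ^ 2) := by rw [hA]
  have hBρ : ρ ^ 2 * (inner ℝ b b₁₁ + inner ℝ b b₂₂) = ρ ^ 2 * (-2 * ‖b‖ ^ 2) := by rw [hBB]
  have hqa : ‖a‖ ^ 2 * q = ‖a‖ ^ 2 * (c₁ ^ 2 + c₂ ^ 2) := by rw [← hq]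
  linarith

/-- Interior gradient estimate, by Bernstein's maximum principle argument. -/
theorem IsEigenOn.norm_fderiv_apply_le (hv : IsEigenOn v B) (hB : IsOpen B)
    {x₀ e : EuclideanSpace ℝ (Fin 2)} {ρ m : ℝ} (hρ : 0 < ρ) (hρ1 : ρ ≤ 1) (hm : 0 < m)
    (hsub : closedBall x₀ ρ ⊆ B) (hbd : ∀ x ∈ closedBall x₀ ρ, ‖v x‖ ≤ m) (he : ‖e‖ ≤ 1) :
    ‖fderiv ℝ v x₀ e‖ ≤ 8 / ρ * m := by
  set w : EuclideanSpace ℝ (Fin 2) → H := fun y => fderiv ℝ v y e with hw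
  have hwE : IsEigenOn w B := hv.fderiv_apply hB e
  set W : EuclideanSpace ℝ (Fin 2) → ℝ := fun x =>
    (ρ ^ 2 - ‖x - x₀‖ ^ 2) ^ 2 * inner ℝ (w x) (w x) + 18 * ρ ^ 2 * inner ℝ (v x) (v x)
      + 36 * ρ ^ 2 * m ^ 2 * ‖x - x₀‖ ^ 2 with hW
  have hx₀ : x₀ ∈ closedBall x₀ ρ := mem_closedBall_self hρ.le
  have hWc : ContinuousOn W (closedBall x₀ ρ) := by
    have h1 := hwE.contDiffOn.continuousOn.mono hsub
    have h2 := hv.contDiffOn.continuousOn.mono hsub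
    exact (((by fun_prop : ContinuousOn (fun x => (ρ ^ 2 - ‖x - x₀‖ ^ 2) ^ 2) _).mul
      (h1.inner h1)).add (continuousOn_const.mul (h2.inner h2))).add (by fun_prop)
  obtain ⟨y, hy, hmax⟩ := (isCompact_closedBall x₀ ρ).exists_isMaxOn ⟨x₀, hx₀⟩ hWc
  have hyρ : ‖y - x₀‖ = ρ := by
    refine le_antisymm (mem_closedBall_iff_norm.1 hy) (not_lt.1 fun hlt => ?_)
    have hyB : y ∈ B := hsub hy
    have hloc : IsLocalMax W y :=
      hmax.isLocalMax (Filter.mem_of_superset (isOpen_ball.mem_nhds (mem_ball_iff_norm.2 hlt))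
        ball_subset_closedBall)
    have hline : ∀ i : Fin 2, ∀ t : ℝ, HasDerivAt
        (fun t : ℝ => y + t • EuclideanSpace.single i (1 : ℝ)) (EuclideanSpace.single i 1) t := by
      intro i t
      simpa using ((hasDerivAt_id t).smul_const (EuclideanSpace.single i (1 : ℝ))).const_add y
    have htend : ∀ i : Fin 2, Filter.Tendsto
        (fun t : ℝ => y + t • EuclideanSpace.single i (1 : ℝ)) (nhds 0) (nhds y) := by
      intro i
      simpa using (hline i 0).continuousAt.tendsto
    have hder : ∀ {g : EuclideanSpace ℝ (Fin 2) → H}, ContDiffOn ℝ (⊤ : ℕ∞) g B → ∀ i : Fin 2,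
        ∀ᶠ t : ℝ in nhds 0, HasDerivAt
          (fun t : ℝ => g (y + t • EuclideanSpace.single i (1 : ℝ)))
          (fderiv ℝ g (y + t • EuclideanSpace.single i (1 : ℝ)) (EuclideanSpace.single i 1)) t := by
      intro g hg i
      filter_upwards [(htend i).eventually (hB.mem_nhds hyB)] with t ht
      have hgd : DifferentiableAt ℝ g (y + t • EuclideanSpace.single i (1 : ℝ)) :=
        (hg.contDiffAt (hB.mem_nhds ht)).differentiableAt (by simp)
      exact hgd.hasFDerivAt.comp_hasDerivAt t (hline i t)
    have hnorm : ∀ (i : Fin 2) (t : ℝ), ‖y + t • EuclideanSpace.single i (1 : ℝ) - x₀‖ ^ 2 =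
        ‖y - x₀‖ ^ 2 + 2 * (y - x₀) i * t + t ^ 2 := by
      intro i t
      rw [add_sub_right_comm, norm_add_sq_real, inner_smul_right, norm_smul,
        EuclideanSpace.inner_single_right]
      simp
      ring
    have key : ∀ i : Fin 2, _ := fun i =>
      second_deriv_auxiliary_nonpos (c := (y - x₀) i) (q := ‖y - x₀‖ ^ 2) (s := ρ ^ 2)
        (l := 18 * ρ ^ 2) (k := 36 * ρ ^ 2 * m ^ 2)
        (hder hwE.contDiffOn i)
        (hder (contDiffOn_fderiv_apply hwE.contDiffOn hB (EuclideanSpace.single i 1)) i).self_of_nhds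
        (hder hv.contDiffOn i)
        (hder (contDiffOn_fderiv_apply hv.contDiffOn hB (EuclideanSpace.single i 1)) i).self_of_nhds
        (by
          have : IsLocalMax (fun t : ℝ => W (y + t • EuclideanSpace.single i (1 : ℝ))) 0 := by
            have h := (htend i).eventually hloc
            filter_upwards [h] with t ht
            simpa using ht
          simpa only [hW, hnorm] using this)
    have k₀ := key 0
    have k₁ := key 1
    simp only [zero_smul, add_zero] at k₀ k₁
    have hwl := hwE.laplace y hyB
    have hvl := hv.laplace y hyB
    have hws := norm_fderiv_apply_sq_le (v := v) y e he
    rw [Fin.sum_univ_two] at hwl hvl hws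
    exact bernstein_sum_pos hρ hρ1 hm
      (by rw [EuclideanSpace.real_norm_sq_eq, Fin.sum_univ_two]) (by gcongr) hwl hvl hws
      (hbd y hy) k₀ k₁
  have hle : W x₀ ≤ W y := hmax hx₀
  simp only [hW, hyρ, sub_self, norm_zero, real_inner_self_eq_norm_sq] at hle
  have hb2 : ‖v y‖ ^ 2 ≤ m ^ 2 := by
    have := hbd y hy
    gcongr
  have h1 : ρ ^ 2 * (ρ * ‖w x₀‖) ^ 2 ≤ ρ ^ 2 * (8 * m) ^ 2 := by
    have : 0 ≤ ρ ^ 2 * (m ^ 2 - ‖v y‖ ^ 2) := mul_nonneg (by positivity) (by linarith)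
    have h2 : 0 ≤ ρ ^ 2 * ‖v x₀‖ ^ 2 := by positivity
    have h3 : ρ ^ 2 * m ^ 2 * ρ ^ 2 ≤ ρ ^ 2 * m ^ 2 * 1 := by
      gcongr; nlinarith
    have h4 : 0 ≤ ρ ^ 2 * m ^ 2 := by positivity
    nlinarith
  have h2 : ρ * ‖w x₀‖ ≤ 8 * m :=
    le_of_sq_le_sq (le_of_mul_le_mul_left h1 (by positivity)) (by positivity)
  rw [div_mul_eq_mul_div, le_div_iff₀ hρ, mul_comm]
  exact h2

theorem iteratedFDeriv_succ_apply_eq_fderiv_apply_last (hv : ContDiffOn ℝ (⊤ : ℕ∞) v B)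
    (hB : IsOpen B) {x : EuclideanSpace ℝ (Fin 2)} (hx : x ∈ B) {n : ℕ}
    (e : Fin (n + 1) → EuclideanSpace ℝ (Fin 2)) :
    iteratedFDeriv ℝ (n + 1) v x e =
      iteratedFDeriv ℝ n (fun y => fderiv ℝ v y (e (Fin.last n))) x (Fin.init e) := by
  have hc : (fun y => fderiv ℝ v y (e (Fin.last n))) =
      ContinuousLinearMap.apply ℝ H (e (Fin.last n)) ∘ fderiv ℝ v := rfl
  have hd : ContDiffAt ℝ n (fderiv ℝ v) x :=
    (hv.fderiv_of_isOpen (m := n) hB (by exact_mod_cast le_top)).contDiffAt (hB.mem_nhds hx)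
  rw [iteratedFDeriv_succ_apply_right, hc,
    ContinuousLinearMap.iteratedFDeriv_comp_left _ hd le_rfl]
  rfl

theorem IsEigenOn.norm_iteratedFDeriv_le (hB : IsOpen B) {ρ : ℝ} (hρ : 0 < ρ) (hρ1 : ρ ≤ 1)
    (n : ℕ) : ∀ {v : EuclideanSpace ℝ (Fin 2) → H} {m : ℝ} {x : EuclideanSpace ℝ (Fin 2)},
      IsEigenOn v B → 0 < m → closedBall x (n * ρ) ⊆ B →
      (∀ y ∈ closedBall x (n * ρ), ‖v y‖ ≤ m) →
      ‖iteratedFDeriv ℝ n v x‖ ≤ (8 / ρ) ^ n * m := by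
  induction n with
  | zero =>
    intro v m x hv hm hsub hbd
    simpa using hbd x (by simp)
  | succ n ih =>
    intro v m x hv hm hsub hbd
    have hxB : x ∈ B := hsub (mem_closedBall_self (by positivity))
    refine ContinuousMultilinearMap.opNorm_le_bound (by positivity) fun e => ?_
    set f := e (Fin.last n) with hf
    rcases eq_or_ne f 0 with h0 | h0
    · rw [ContinuousMultilinearMap.map_coord_zero _ (Fin.last n) (hf.symm.trans h0), norm_zero]
      positivity
    have hfpos : 0 < ‖f‖ := norm_pos_iff.2 h0
    set w : EuclideanSpace ℝ (Fin 2) → H := fun y => fderiv ℝ v y f with hw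
    have hsucc : ((n + 1 : ℕ) : ℝ) * ρ = n * ρ + ρ := by push_cast; ring
    rw [hsucc] at hsub hbd
    have hwm : ∀ y ∈ closedBall x (n * ρ), ‖w y‖ ≤ 8 / ρ * m * ‖f‖ := by
      intro y hy
      have hyx : closedBall y ρ ⊆ closedBall x (n * ρ + ρ) :=
        closedBall_subset_closedBall' (by rw [mem_closedBall] at hy; linarith)
      have h := hv.norm_fderiv_apply_le hB (e := ‖f‖⁻¹ • f) hρ hρ1 hm (hyx.trans hsub)
        (fun z hz => hbd z (hyx hz)) (by rw [norm_smul, norm_inv, norm_norm,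
          inv_mul_cancel₀ hfpos.ne'])
      rw [map_smul, norm_smul, norm_inv, norm_norm, inv_mul_le_iff₀ hfpos] at h
      linarith
    have hiter : iteratedFDeriv ℝ (n + 1) v x e = iteratedFDeriv ℝ n w x (Fin.init e) :=
      iteratedFDeriv_succ_apply_eq_fderiv_apply_last hv.contDiffOn hB hxB e
    have hn : closedBall x (n * ρ) ⊆ B :=
      (closedBall_subset_closedBall (by linarith)).trans hsub
    have := ih (hv.fderiv_apply hB f) (by positivity) hn hwm
    rw [hiter, Fin.prod_univ_castSucc, ← hf]
    have hP : 0 ≤ ∏ i, ‖Fin.init e i‖ := Finset.prod_nonneg fun i _ => norm_nonneg _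
    refine (ContinuousMultilinearMap.le_opNorm _ _).trans
      ((mul_le_mul_of_nonneg_right this hP).trans_eq ?_)
    simp only [Fin.init, pow_succ]
    ring

end

theorem natCast_pow_self_le_exp_one_pow_mul_factorial (n : ℕ) :
    (n : ℝ) ^ n ≤ Real.exp 1 ^ n * n.factorial := by
  have h := Real.pow_div_factorial_le_exp _ (Nat.cast_nonneg (α := ℝ) n) n
  rwa [div_le_iff₀ (by positivity), ← mul_one (n : ℝ), Real.exp_nat_mul, mul_one] at h




/-- Cauchy-type interior estimates for Hilbert-space-valued eigenfunctions of the Laplacian: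
if `u : ℝ² → H` is smooth on `B(p,R)` and satisfies `Δu = -2u` there, then for every
`r ∈ (0,R)` there are constants `M, C > 0` with
`‖Dⁿu(x)‖ ≤ n! M Cⁿ (R-r)⁻ⁿ` for all `n` and all `x ∈ B(p,r)`. -/
theorem cauchy_interior_estimates
    (H : Type*) [NormedAddCommGroup H] [InnerProductSpace ℝ H]
    [CompleteSpace H] [TopologicalSpace.SeparableSpace H]
    (p : EuclideanSpace ℝ (Fin 2)) (R : ℝ) (hR : 0 < R)
    (u : EuclideanSpace ℝ (Fin 2) → H)
    (hu : ContDiffOn ℝ (⊤ : ℕ∞) u (ball p R))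
    (hlap : ∀ x ∈ ball p R,
      iteratedFDerivWithin ℝ 2 u (ball p R) x
          ![EuclideanSpace.single (0 : Fin 2) (1 : ℝ), EuclideanSpace.single (0 : Fin 2) (1 : ℝ)] +
        iteratedFDerivWithin ℝ 2 u (ball p R) x
          ![EuclideanSpace.single (1 : Fin 2) (1 : ℝ), EuclideanSpace.single (1 : Fin 2) (1 : ℝ)]
        = (-2 : ℝ) • u x) :
    ∀ r ∈ Set.Ioo (0 : ℝ) R, ∃ M > (0 : ℝ), ∃ C > (0 : ℝ),
      ∀ (n : ℕ), ∀ x ∈ ball p r,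
        ‖iteratedFDerivWithin ℝ n u (ball p R) x‖ ≤
          (Nat.factorial n : ℝ) * M * C ^ n * ((R - r) ^ n)⁻¹ := by
  rintro r ⟨hr0, hrR⟩
  have hB : IsOpen (ball p R) := isOpen_ball
  have hE : IsEigenOn u (ball p R) := by
    refine ⟨hu, fun x hx => ?_⟩
    have hd : DifferentiableAt ℝ (fderiv ℝ u) x :=
      ((hu.fderiv_of_isOpen (m := 1) hB (by norm_cast)).contDiffAt
        (hB.mem_nhds hx)).differentiableAt (by simp)
    have h := hlap x hx
    rw [iteratedFDerivWithin_of_isOpen 2 hB hx, iteratedFDeriv_two_apply,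
      iteratedFDeriv_two_apply] at h
    rw [Fin.sum_univ_two, ← h, fderiv_clm_apply hd (differentiableAt_const _),
      fderiv_clm_apply hd (differentiableAt_const _)]
    simp
  set δ := min 1 ((R - r) / 2) with hδ
  have hδ0 : 0 < δ := lt_min one_pos (by linarith)
  have hδ1 : δ ≤ 1 := min_le_left _ _
  have hδr : δ ≤ (R - r) / 2 := min_le_right _ _
  have hsub : closedBall p (r + δ) ⊆ ball p R := closedBall_subset_ball (by linarith)
  obtain ⟨M, hM⟩ := (isCompact_closedBall p (r + δ)).exists_bound_of_continuousOn
    (hu.continuousOn.mono hsub)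
  have hRr : 0 < R - r := by linarith
  refine ⟨max M 1, by positivity, 8 * Real.exp 1 / δ * (R - r), by positivity, fun n x hx => ?_⟩
  have hxp : closedBall x δ ⊆ closedBall p (r + δ) :=
    closedBall_subset_closedBall' (by rw [mem_ball] at hx; linarith)
  have hxB : x ∈ ball p R := ball_subset_ball hrR.le hx
  have hbd : ∀ y ∈ closedBall x δ, ‖u y‖ ≤ max M 1 := fun y hy =>
    (hM y (hxp hy)).trans (le_max_left _ _)
  rw [iteratedFDerivWithin_of_isOpen n hB hxB]
  rcases Nat.eq_zero_or_pos n with rfl | hn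
  · simpa using hbd x (mem_closedBall_self hδ0.le)
  have hn' : (0 : ℝ) < n := by exact_mod_cast hn
  have hn1 : (1 : ℝ) ≤ n := by exact_mod_cast hn
  have hnδ : (n : ℝ) * (δ / n) = δ := mul_div_cancel₀ _ hn'.ne'
  have h := IsEigenOn.norm_iteratedFDeriv_le hB (ρ := δ / n) (by positivity)
    ((div_le_self hδ0.le hn1).trans hδ1) n hE (m := max M 1) (x := x) (by positivity)
    (by rw [hnδ]; exact hxp.trans hsub) (by rw [hnδ]; exact hbd)
  refine h.trans ?_
  calc (8 / (δ / n)) ^ n * max M 1 = (8 / δ) ^ n * (n : ℝ) ^ n * max M 1 := by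
        rw [← mul_pow]; congr 2; field_simp
    _ ≤ (8 / δ) ^ n * (Real.exp 1 ^ n * n.factorial) * max M 1 := by
        gcongr
        exact natCast_pow_self_le_exp_one_pow_mul_factorial n
    _ = n.factorial * max M 1 * (8 * Real.exp 1 / δ * (R - r)) ^ n * ((R - r) ^ n)⁻¹ := by
        rw [mul_pow _ (R - r), mul_div_right_comm, mul_pow _ (Real.exp 1)]
        field_simp
end

section
/- Let H be a separable real Hilbert space, let U ⊆ ℝ² be an open set, and let u : ℝ² → H be a map which is smooth (infinitely Fréchet differentiable) on U and satisfies Δu = −2u on U, where Δu(x) = D²u(x)(ξ₁,ξ₁) + D²u(x)(ξ₂,ξ₂) is the Laplacian computed from the second Fréchet derivative of u and the standard orthonormal basis ξ₁, ξ₂ of ℝ². Then u is real-analytic on U: for every point of U, u is given in a neighborhood of that point by a convergent power series with values in H (i.e., u is analytic on U as a map between the real Banach spaces ℝ² and H). -/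
open Set Filter Topology Metric

/-- The second derivative test at a local maximum, as a necessary condition. -/
theorem IsLocalMax.hasDerivAt_hasDerivAt_nonpos {g g' : ℝ → ℝ} {g'' a : ℝ} (hm : IsLocalMax g a)
    (h₁ : ∀ᶠ t in 𝓝 a, HasDerivAt g (g' t) t) (h₂ : HasDerivAt g' g'' a) : g'' ≤ 0 := by
  by_contra! hpos
  have hd : deriv g =ᶠ[𝓝 a] g' := h₁.mono fun t ht ↦ ht.deriv
  have hdd : deriv (deriv g) a = g'' := hd.deriv_eq.trans h₂.deriv
  have hmin : IsLocalMin g a := isLocalMin_of_deriv_deriv_pos (hdd ▸ hpos) hm.deriv_eq_zero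
    h₁.self_of_nhds.continuousAt
  have hconst : g =ᶠ[𝓝 a] fun _ ↦ g a := by
    filter_upwards [hm, hmin] with t h h' using le_antisymm h h'
  have : deriv (deriv g) a = 0 := by
    rw [hconst.deriv.deriv_eq]
    simp
  linarith

/-- The weak maximum principle for strictly subharmonic functions on a rectangle. -/
theorem nonpos_on_rectangle_of_laplacian_pos {f fx fxx fy fyy : ℝ → ℝ → ℝ} {a₀ a₁ b₀ b₁ : ℝ}
    (hc : ContinuousOn (fun q : ℝ × ℝ ↦ f q.1 q.2) (Icc a₀ a₁ ×ˢ Icc b₀ b₁))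
    (hfx : ∀ a ∈ Ioo a₀ a₁, ∀ b ∈ Ioo b₀ b₁, HasDerivAt (fun t ↦ f t b) (fx a b) a)
    (hfxx : ∀ a ∈ Ioo a₀ a₁, ∀ b ∈ Ioo b₀ b₁, HasDerivAt (fun t ↦ fx t b) (fxx a b) a)
    (hfy : ∀ a ∈ Ioo a₀ a₁, ∀ b ∈ Ioo b₀ b₁, HasDerivAt (fun t ↦ f a t) (fy a b) b)
    (hfyy : ∀ a ∈ Ioo a₀ a₁, ∀ b ∈ Ioo b₀ b₁, HasDerivAt (fun t ↦ fy a t) (fyy a b) b)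
    (hpos : ∀ a ∈ Ioo a₀ a₁, ∀ b ∈ Ioo b₀ b₁, 0 < fxx a b + fyy a b)
    (hleft : ∀ b ∈ Icc b₀ b₁, f a₀ b ≤ 0) (hright : ∀ b ∈ Icc b₀ b₁, f a₁ b ≤ 0)
    (hbot : ∀ a ∈ Icc a₀ a₁, f a b₀ ≤ 0) (htop : ∀ a ∈ Icc a₀ a₁, f a b₁ ≤ 0)
    {a b : ℝ} (ha : a ∈ Icc a₀ a₁) (hb : b ∈ Icc b₀ b₁) : f a b ≤ 0 := by
  obtain ⟨⟨p, q⟩, ⟨hp, hq⟩, hmax⟩ := (isCompact_Icc.prod isCompact_Icc).exists_isMaxOn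
    ⟨(a, b), ha, hb⟩ hc
  dsimp only at hp hq
  refine (hmax (show (a, b) ∈ Icc a₀ a₁ ×ˢ Icc b₀ b₁ from ⟨ha, hb⟩)).trans ?_
  dsimp only
  rcases hp.1.eq_or_lt with rfl | hp₀
  · exact hleft q hq
  rcases hp.2.eq_or_lt with rfl | hp₁
  · exact hright q hq
  rcases hq.1.eq_or_lt with rfl | hq₀
  · exact hbot p hp
  rcases hq.2.eq_or_lt with rfl | hq₁
  · exact htop p hp
  exfalso
  have hx : IsLocalMax (fun t ↦ f t q) p := by
    filter_upwards [Ioo_mem_nhds hp₀ hp₁] with t ht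
    exact hmax (show (t, q) ∈ Icc a₀ a₁ ×ˢ Icc b₀ b₁ from ⟨Ioo_subset_Icc_self ht, hq⟩)
  have hy : IsLocalMax (fun t ↦ f p t) q := by
    filter_upwards [Ioo_mem_nhds hq₀ hq₁] with t ht
    exact hmax (show (p, t) ∈ Icc a₀ a₁ ×ˢ Icc b₀ b₁ from ⟨hp, Ioo_subset_Icc_self ht⟩)
  have h₁ := hx.hasDerivAt_hasDerivAt_nonpos (g' := fun t ↦ fx t q)
    (by filter_upwards [Ioo_mem_nhds hp₀ hp₁] with t ht using hfx t ht q ⟨hq₀, hq₁⟩)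
    (hfxx p ⟨hp₀, hp₁⟩ q ⟨hq₀, hq₁⟩)
  have h₂ := hy.hasDerivAt_hasDerivAt_nonpos (g' := fun t ↦ fy p t)
    (by filter_upwards [Ioo_mem_nhds hq₀ hq₁] with t ht using hfy p ⟨hp₀, hp₁⟩ t ht)
    (hfyy p ⟨hp₀, hp₁⟩ q ⟨hq₀, hq₁⟩)
  linarith [hpos p ⟨hp₀, hp₁⟩ q ⟨hq₀, hq₁⟩]

/-- Interior gradient bound for solutions of `Δw = -2w` on the square of half-side `d`, obtained by
comparing the odd part of `w` in the second variable with an explicit barrier. -/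
theorem deriv_le_of_laplacian_eq_neg_two_mul {w wx wxx wy wyy : ℝ → ℝ → ℝ} {d M : ℝ} (hd : 0 < d)
    (hM : 0 < M)
    (hc : ContinuousOn (fun q : ℝ × ℝ ↦ w q.1 q.2) (Icc (-d) d ×ˢ Icc (-d) d))
    (hwx : ∀ a ∈ Ioo (-d) d, ∀ b ∈ Ioo (-d) d, HasDerivAt (fun t ↦ w t b) (wx a b) a)
    (hwxx : ∀ a ∈ Ioo (-d) d, ∀ b ∈ Ioo (-d) d, HasDerivAt (fun t ↦ wx t b) (wxx a b) a)
    (hwy : ∀ a ∈ Ioo (-d) d, ∀ b ∈ Ioo (-d) d, HasDerivAt (fun t ↦ w a t) (wy a b) b)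
    (hwyy : ∀ a ∈ Ioo (-d) d, ∀ b ∈ Ioo (-d) d, HasDerivAt (fun t ↦ wy a t) (wyy a b) b)
    (hlap : ∀ a ∈ Ioo (-d) d, ∀ b ∈ Ioo (-d) d, wxx a b + wyy a b = -2 * w a b)
    (hbound : ∀ a ∈ Icc (-d) d, ∀ b ∈ Icc (-d) d, |w a b| ≤ M) :
    wy 0 0 ≤ 2 * M / d + 3 * M * d / 2 := by
  have hneg : ∀ {b}, b ∈ Icc 0 d → b ∈ Icc (-d) d ∧ -b ∈ Icc (-d) d := fun hb ↦
    ⟨⟨by linarith [hb.1], hb.2⟩, by linarith [hb.2], by linarith [hb.1]⟩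
  have hneg' : ∀ {b}, b ∈ Ioo 0 d → b ∈ Ioo (-d) d ∧ -b ∈ Ioo (-d) d := fun hb ↦
    ⟨⟨by linarith [hb.1], hb.2⟩, by linarith [hb.2], by linarith [hb.1]⟩
  have hMd : M / d ^ 2 * d ^ 2 = M := by field_simp
  have hMd0 : 0 < M / d ^ 2 := by positivity
  have key : ∀ b ∈ Icc 0 d, (w 0 b - w 0 (-b)) / 2 -
      (M / d ^ 2 * (0 ^ 2 + b * (2 * d - b)) + 3 * M / 2 * (b * (d - b))) ≤ 0 := by
    intro b hb
    refine nonpos_on_rectangle_of_laplacian_pos (a₀ := -d) (a₁ := d) (b₀ := 0) (b₁ := d)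
      (f := fun a b ↦ (w a b - w a (-b)) / 2 -
        (M / d ^ 2 * (a ^ 2 + b * (2 * d - b)) + 3 * M / 2 * (b * (d - b))))
      (fx := fun a b ↦ (wx a b - wx a (-b)) / 2 - M / d ^ 2 * (2 * a))
      (fxx := fun a b ↦ (wxx a b - wxx a (-b)) / 2 - M / d ^ 2 * 2)
      (fy := fun a b ↦ (wy a b + wy a (-b)) / 2 -
        (M / d ^ 2 * (2 * d - 2 * b) + 3 * M / 2 * (d - 2 * b)))
      (fyy := fun a b ↦ (wyy a b - wyy a (-b)) / 2 - (M / d ^ 2 * (-2) + 3 * M / 2 * (-2)))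
      ?_ ?_ ?_ ?_ ?_ ?_ ?_ ?_ ?_ ?_ ⟨by linarith, hd.le⟩ hb
    · have h₁ : ContinuousOn (fun q : ℝ × ℝ ↦ w q.1 q.2) (Icc (-d) d ×ˢ Icc 0 d) :=
        hc.mono (prod_mono_right fun b hb ↦ (hneg hb).1)
      have h₂ : ContinuousOn (fun q : ℝ × ℝ ↦ w q.1 (-q.2)) (Icc (-d) d ×ˢ Icc 0 d) :=
        hc.comp (f := fun q : ℝ × ℝ ↦ (q.1, -q.2)) (by fun_prop)
          fun q hq ↦ ⟨hq.1, (hneg hq.2).2⟩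
      exact ((h₁.sub h₂).div_const 2).sub (by fun_prop)
    · intro a ha b hb
      have h₁ := hwx a ha b (hneg' hb).1
      have h₂ := hwx a ha (-b) (hneg' hb).2
      refine (((h₁.sub h₂).div_const 2).sub ((((hasDerivAt_pow 2 a).add_const _).const_mul
        (M / d ^ 2)).add_const _)).congr_deriv ?_
      simp
    · intro a ha b hb
      have h₁ := hwxx a ha b (hneg' hb).1
      have h₂ := hwxx a ha (-b) (hneg' hb).2
      refine (((h₁.sub h₂).div_const 2).sub ((((hasDerivAt_id a).const_mul 2)).const_mul
        (M / d ^ 2))).congr_deriv ?_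
      simp
    · intro a ha b hb
      have h₁ := hwy a ha b (hneg' hb).1
      have h₂ := (hwy a ha (-b) (hneg' hb).2).scomp b (hasDerivAt_neg b)
      have h₃ := (hasDerivAt_id b).mul ((hasDerivAt_id b).const_sub (2 * d))
      have h₄ := (hasDerivAt_id b).mul ((hasDerivAt_id b).const_sub d)
      refine (((h₁.sub h₂).div_const 2).sub (((h₃.const_add (a ^ 2)).const_mul
        (M / d ^ 2)).add (h₄.const_mul (3 * M / 2)))).congr_deriv ?_
      simp
      ring
    · intro a ha b hb
      have h₁ := hwyy a ha b (hneg' hb).1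
      have h₂ := (hwyy a ha (-b) (hneg' hb).2).scomp b (hasDerivAt_neg b)
      have h₃ := ((hasDerivAt_id b).const_mul 2).const_sub (2 * d)
      have h₄ := ((hasDerivAt_id b).const_mul 2).const_sub d
      refine (((h₁.add h₂).div_const 2).sub ((h₃.const_mul
        (M / d ^ 2)).add (h₄.const_mul (3 * M / 2)))).congr_deriv ?_
      simp
      ring
    · intro a ha b hb
      have h₁ := hlap a ha b (hneg' hb).1
      have h₂ := hlap a ha (-b) (hneg' hb).2
      have h₃ := abs_le.1 (hbound a (Ioo_subset_Icc_self ha) b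
        (Ioo_subset_Icc_self (hneg' hb).1))
      have h₄ := abs_le.1 (hbound a (Ioo_subset_Icc_self ha) (-b)
        (Ioo_subset_Icc_self (hneg' hb).2))
      linarith
    · intro b hb
      have h₃ := abs_le.1 (hbound (-d) ⟨le_rfl, by linarith⟩ b (hneg hb).1)
      have h₄ := abs_le.1 (hbound (-d) ⟨le_rfl, by linarith⟩ (-b) (hneg hb).2)
      have h₅ : 0 ≤ M / d ^ 2 * (b * (2 * d - b)) :=
        mul_nonneg hMd0.le (mul_nonneg hb.1 (by linarith [hb.2]))
      have h₆ : 0 ≤ 3 * M / 2 * (b * (d - b)) :=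
        mul_nonneg (by positivity) (mul_nonneg hb.1 (by linarith [hb.2]))
      rw [mul_add, neg_sq, hMd]
      linarith
    · intro b hb
      have h₃ := abs_le.1 (hbound d ⟨by linarith, le_rfl⟩ b (hneg hb).1)
      have h₄ := abs_le.1 (hbound d ⟨by linarith, le_rfl⟩ (-b) (hneg hb).2)
      have h₅ : 0 ≤ M / d ^ 2 * (b * (2 * d - b)) :=
        mul_nonneg hMd0.le (mul_nonneg hb.1 (by linarith [hb.2]))
      have h₆ : 0 ≤ 3 * M / 2 * (b * (d - b)) :=
        mul_nonneg (by positivity) (mul_nonneg hb.1 (by linarith [hb.2]))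
      rw [mul_add, hMd]
      linarith
    · intro a _
      simp only [neg_zero, sub_self, zero_mul, zero_div, add_zero, mul_zero, zero_sub]
      simp only [Left.neg_nonpos_iff]
      positivity
    · intro a ha
      have hd' : d ∈ Icc 0 d := ⟨hd.le, le_rfl⟩
      have h₃ := abs_le.1 (hbound a ha d (hneg hd').1)
      have h₄ := abs_le.1 (hbound a ha (-d) (hneg hd').2)
      have h₅ : 0 ≤ M / d ^ 2 * a ^ 2 := by positivity
      have h₆ : M / d ^ 2 * (a ^ 2 + d * (2 * d - d)) = M / d ^ 2 * a ^ 2 + M := by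
        rw [← hMd]; field_simp; ring
      rw [h₆, sub_self, mul_zero, mul_zero]
      linarith
  have h0 : (0 : ℝ) ∈ Ioo (-d) d := ⟨by linarith, hd⟩
  have h₁ := hwy 0 h0 0 h0
  have h₁' : HasDerivAt (fun t ↦ w 0 t) (wy 0 0) (-0) := by rwa [neg_zero]
  have h₂ := h₁'.scomp 0 (hasDerivAt_neg (0 : ℝ))
  have h₃ := (hasDerivAt_id (0 : ℝ)).mul ((hasDerivAt_id (0 : ℝ)).const_sub (2 * d))
  have h₄ := (hasDerivAt_id (0 : ℝ)).mul ((hasDerivAt_id (0 : ℝ)).const_sub d)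
  have hder := ((h₁.sub h₂).div_const 2).sub (((h₃.const_add (0 ^ 2)).const_mul
        (M / d ^ 2)).add (h₄.const_mul (3 * M / 2)))
  have hle := (hasDerivAt_iff_tendsto_slope.1 hder).mono_left
    (nhdsWithin_mono (0 : ℝ) (fun t (ht : t ∈ Ioi 0) ↦ ne_of_gt ht))
  have hfin := le_of_tendsto hle (b := 0) (by
    filter_upwards [Ioc_mem_nhdsGT hd] with t ht
    have := key t ⟨ht.1.le, ht.2⟩
    simp only [slope_def_field]
    refine div_nonpos_of_nonpos_of_nonneg ?_ (by linarith [ht.1])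
    simpa using this)
  have h₆ : M / d ^ 2 * (2 * d) = 2 * M / d := by field_simp
  simp at hfin
  linarith

section Gradient

variable {E F : Type*} [NormedAddCommGroup E] [NormedSpace ℝ E] [NormedAddCommGroup F]
  [NormedSpace ℝ F]

/-- Interior estimate for the derivative of a solution of `Δu = -2u` in a coordinate direction. -/
theorem norm_fderiv_apply_le_of_laplacian_eq {u : E → F} {U : Set E} (hU : IsOpen U)
    (hu : ContDiffOn ℝ 2 u U) {e e' : E} (he : ‖e‖ ≤ 1) (he' : ‖e'‖ ≤ 1)
    (hlap : ∀ x ∈ U, fderiv ℝ (fderiv ℝ u) x e e + fderiv ℝ (fderiv ℝ u) x e' e' = (-2 : ℝ) • u x)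
    {x : E} {s M : ℝ} (hs : 0 < s) (hs1 : s ≤ 1) (hM : 0 < M) (hsub : closedBall x s ⊆ U)
    (hbound : ∀ y ∈ closedBall x s, ‖u y‖ ≤ M) : ‖fderiv ℝ u x e'‖ ≤ 5 * M / s := by
  obtain ⟨L, hL, hLx⟩ := exists_dual_vector'' ℝ (fderiv ℝ u x e')
  set q : ℝ → ℝ → E := fun a b ↦ x + (a • e + b • e') with hq
  have hqmem : ∀ a ∈ Icc (-(s / 2)) (s / 2), ∀ b ∈ Icc (-(s / 2)) (s / 2),
      q a b ∈ closedBall x s := by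
    intro a ha b hb
    rw [mem_closedBall, dist_eq_norm, hq, add_sub_cancel_left]
    calc ‖a • e + b • e'‖ ≤ ‖a • e‖ + ‖b • e'‖ := norm_add_le _ _
      _ = |a| * ‖e‖ + |b| * ‖e'‖ := by simp [norm_smul]
      _ ≤ s / 2 * 1 + s / 2 * 1 := by
        gcongr
        · exact abs_le.2 ha
        · exact abs_le.2 hb
      _ = s := by ring
  have hqU : ∀ a ∈ Ioo (-(s / 2)) (s / 2), ∀ b ∈ Ioo (-(s / 2)) (s / 2), q a b ∈ U :=
    fun a ha b hb ↦ hsub (hqmem a (Ioo_subset_Icc_self ha) b (Ioo_subset_Icc_self hb))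
  have hqa : ∀ a b, HasDerivAt (fun t ↦ q t b) e a := fun a b ↦ by
    exact (((hasDerivAt_id a).smul_const e).add_const (b • e')).const_add x |>.congr_deriv (one_smul ℝ e)
  have hqb : ∀ a b, HasDerivAt (fun t ↦ q a t) e' b := fun a b ↦ by
    exact (((hasDerivAt_id b).smul_const e').const_add (a • e)).const_add x |>.congr_deriv (one_smul ℝ e')
  have hD : ∀ y ∈ U, HasFDerivAt u (fderiv ℝ u y) y := fun y hy ↦
    ((hu.contDiffAt (hU.mem_nhds hy)).differentiableAt two_ne_zero).hasFDerivAt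
  have hDD : ∀ y ∈ U, HasFDerivAt (fderiv ℝ u) (fderiv ℝ (fderiv ℝ u) y) y := fun y hy ↦
    (((hu.fderiv_of_isOpen (m := 1) hU (by norm_num)).contDiffAt
      (hU.mem_nhds hy)).differentiableAt one_ne_zero).hasFDerivAt
  have hle := deriv_le_of_laplacian_eq_neg_two_mul (d := s / 2) (M := M)
    (w := fun a b ↦ L (u (q a b)))
    (wx := fun a b ↦ L (fderiv ℝ u (q a b) e))
    (wxx := fun a b ↦ L (fderiv ℝ (fderiv ℝ u) (q a b) e e))
    (wy := fun a b ↦ L (fderiv ℝ u (q a b) e'))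
    (wyy := fun a b ↦ L (fderiv ℝ (fderiv ℝ u) (q a b) e' e'))
    (by positivity) hM
    (by
      refine L.continuous.comp_continuousOn (hu.continuousOn.comp (by fun_prop) ?_)
      exact fun z hz ↦ hsub (hqmem _ hz.1 _ hz.2))
    (fun a ha b hb ↦ L.hasFDerivAt.comp_hasDerivAt a
      ((hD _ (hqU a ha b hb)).comp_hasDerivAt a (hqa a b)))
    (fun a ha b hb ↦ L.hasFDerivAt.comp_hasDerivAt a
      ((ContinuousLinearMap.apply ℝ F e).hasFDerivAt.comp_hasDerivAt a
        ((hDD _ (hqU a ha b hb)).comp_hasDerivAt a (hqa a b))))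
    (fun a ha b hb ↦ L.hasFDerivAt.comp_hasDerivAt b
      ((hD _ (hqU a ha b hb)).comp_hasDerivAt b (hqb a b)))
    (fun a ha b hb ↦ L.hasFDerivAt.comp_hasDerivAt b
      ((ContinuousLinearMap.apply ℝ F e').hasFDerivAt.comp_hasDerivAt b
        ((hDD _ (hqU a ha b hb)).comp_hasDerivAt b (hqb a b))))
    (fun a ha b hb ↦ by
      rw [← map_add, hlap _ (hqU a ha b hb)]
      simp)
    (fun a ha b hb ↦ by
      rw [← Real.norm_eq_abs]
      calc ‖L (u (q a b))‖ ≤ ‖L‖ * ‖u (q a b)‖ := L.le_opNorm _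
        _ ≤ 1 * M := by gcongr; exact hbound _ (hqmem a ha b hb)
        _ = M := one_mul M)
  have hq0 : q 0 0 = x := by simp [hq]
  simp only [hq0] at hle
  rw [hLx] at hle
  have h₁ : 2 * M / (s / 2) = 4 * M / s := by field_simp; norm_num
  have h₂ : M * s ≤ M / s := by
    rw [le_div_iff₀ hs]
    nlinarith [mul_le_one₀ hs1 hs.le hs1]
  have h₃ : 5 * M / s = 4 * M / s + M / s := by ring
  have h₄ : 0 < M / s := by positivity
  simp only [RCLike.ofReal_real_eq_id, id] at hle
  linarith

/-- The derivative of a solution of `Δu = -2u` is again a solution. -/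
theorem laplacian_fderiv_eq {u : E → F} {U : Set E} (hU : IsOpen U)
    (hu : ContDiffOn ℝ 3 u U) {e e' : E}
    (hlap : ∀ x ∈ U, fderiv ℝ (fderiv ℝ u) x e e + fderiv ℝ (fderiv ℝ u) x e' e' = (-2 : ℝ) • u x)
    {x : E} (hx : x ∈ U) :
    fderiv ℝ (fderiv ℝ (fderiv ℝ u)) x e e + fderiv ℝ (fderiv ℝ (fderiv ℝ u)) x e' e' =
      (-2 : ℝ) • fderiv ℝ u x := by
  have hu1 : ContDiffOn ℝ 2 (fderiv ℝ u) U := hu.fderiv_of_isOpen hU (by norm_num)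
  have hu2 : ContDiffOn ℝ 1 (fderiv ℝ (fderiv ℝ u)) U := hu1.fderiv_of_isOpen hU (by norm_num)
  have hd : HasFDerivAt (fderiv ℝ (fderiv ℝ u)) (fderiv ℝ (fderiv ℝ (fderiv ℝ u)) x) x :=
    ((hu2.contDiffAt (hU.mem_nhds hx)).differentiableAt one_ne_zero).hasFDerivAt
  have hdapp : ∀ v w : E, HasFDerivAt (fun y ↦ fderiv ℝ (fderiv ℝ u) y v w)
      ((ContinuousLinearMap.apply ℝ F w ∘L ContinuousLinearMap.apply ℝ (E →L[ℝ] F) v) ∘L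
        fderiv ℝ (fderiv ℝ (fderiv ℝ u)) x) x := fun v w ↦
    HasFDerivAt.comp x (g := ContinuousLinearMap.apply ℝ F w ∘L
      ContinuousLinearMap.apply ℝ (E →L[ℝ] F) v) (ContinuousLinearMap.hasFDerivAt _) hd
  have hsymm : ∀ v w z : E, fderiv ℝ (fderiv ℝ (fderiv ℝ u)) x z v w =
      fderiv ℝ (fderiv ℝ (fderiv ℝ u)) x z w v := by
    intro v w z
    have heq : (fun y ↦ fderiv ℝ (fderiv ℝ u) y v w) =ᶠ[𝓝 x]
        fun y ↦ fderiv ℝ (fderiv ℝ u) y w v := by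
      filter_upwards [hU.mem_nhds hx] with y hy
      exact (hu.contDiffAt (hU.mem_nhds hy)).isSymmSndFDerivAt (by simp; norm_num) v w
    exact DFunLike.congr_fun (((hdapp v w).congr_of_eventuallyEq heq.symm).unique (hdapp w v)) z
  have hsymm' : ∀ v z : E, fderiv ℝ (fderiv ℝ (fderiv ℝ u)) x z v =
      fderiv ℝ (fderiv ℝ (fderiv ℝ u)) x v z := fun v z ↦
    (hu1.contDiffAt (hU.mem_nhds hx)).isSymmSndFDerivAt (by simp) z v
  have heq : (fun y ↦ fderiv ℝ (fderiv ℝ u) y e e + fderiv ℝ (fderiv ℝ u) y e' e') =ᶠ[𝓝 x]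
      fun y ↦ (-2 : ℝ) • u y := by
    filter_upwards [hU.mem_nhds hx] with y hy using hlap y hy
  have hdu : HasFDerivAt u (fderiv ℝ u x) x :=
    ((hu.contDiffAt (hU.mem_nhds hx)).differentiableAt three_ne_zero).hasFDerivAt
  have hkey := (((hdapp e e).add (hdapp e' e')).congr_of_eventuallyEq heq.symm).unique
    (hdu.const_smul (-2 : ℝ))
  ext z
  have hz := DFunLike.congr_fun hkey z
  simp only [add_apply]
  rw [hsymm e z e, hsymm e' z e', hsymm' z e, hsymm' z e']
  exact hz

end Gradient

/-- Interior gradient estimate for solutions of `Δu = -2u` in the plane. -/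
theorem norm_fderiv_le_of_laplacian_eq {F : Type*} [NormedAddCommGroup F] [NormedSpace ℝ F]
    {u : EuclideanSpace ℝ (Fin 2) → F} {U : Set (EuclideanSpace ℝ (Fin 2))} (hU : IsOpen U)
    (hu : ContDiffOn ℝ 2 u U)
    (hlap : ∀ x ∈ U,
      fderiv ℝ (fderiv ℝ u) x (EuclideanSpace.single 0 1) (EuclideanSpace.single 0 1) +
        fderiv ℝ (fderiv ℝ u) x (EuclideanSpace.single 1 1) (EuclideanSpace.single 1 1) =
      (-2 : ℝ) • u x)
    {x : EuclideanSpace ℝ (Fin 2)} {s M : ℝ} (hs : 0 < s) (hs1 : s ≤ 1) (hM : 0 < M)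
    (hsub : closedBall x s ⊆ U)
    (hbound : ∀ y ∈ closedBall x s, ‖u y‖ ≤ M) : ‖fderiv ℝ u x‖ ≤ 10 / s * M := by
  have h₀ := norm_fderiv_apply_le_of_laplacian_eq hU hu (e := EuclideanSpace.single 1 1)
    (e' := EuclideanSpace.single 0 1) (by simp) (by simp)
    (fun x hx ↦ by rw [add_comm]; exact hlap x hx) hs hs1 hM hsub hbound
  have h₁ := norm_fderiv_apply_le_of_laplacian_eq hU hu (e := EuclideanSpace.single 0 1)
    (e' := EuclideanSpace.single 1 1) (by simp) (by simp) hlap hs hs1 hM hsub hbound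
  refine ContinuousLinearMap.opNorm_le_bound _ (by positivity) fun v ↦ ?_
  have hv : v = v 0 • EuclideanSpace.single 0 1 + v 1 • EuclideanSpace.single 1 1 := by
    ext i
    fin_cases i <;> simp
  calc ‖fderiv ℝ u x v‖
      = ‖v 0 • fderiv ℝ u x (EuclideanSpace.single 0 1) +
          v 1 • fderiv ℝ u x (EuclideanSpace.single 1 1)‖ := by
        conv_lhs => rw [hv]
        simp only [map_add, map_smul]
    _ ≤ ‖v 0‖ * ‖fderiv ℝ u x (EuclideanSpace.single 0 1)‖ +
          ‖v 1‖ * ‖fderiv ℝ u x (EuclideanSpace.single 1 1)‖ := by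
        refine (norm_add_le _ _).trans_eq ?_
        rw [norm_smul, norm_smul]
    _ ≤ ‖v‖ * (5 * M / s) + ‖v‖ * (5 * M / s) := by
        gcongr
        · exact PiLp.norm_apply_le v 0
        · exact PiLp.norm_apply_le v 1
    _ = 10 / s * M * ‖v‖ := by ring

/-- Cauchy-type estimates for all derivatives of solutions of `Δu = -2u` in the plane. -/
theorem norm_iteratedFDeriv_le_of_laplacian_eq (k : ℕ) {F : Type*} [NormedAddCommGroup F]
    [NormedSpace ℝ F]
    {u : EuclideanSpace ℝ (Fin 2) → F} {U : Set (EuclideanSpace ℝ (Fin 2))} (hU : IsOpen U)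
    (hu : ContDiffOn ℝ (⊤ : ℕ∞) u U)
    (hlap : ∀ x ∈ U,
      fderiv ℝ (fderiv ℝ u) x (EuclideanSpace.single 0 1) (EuclideanSpace.single 0 1) +
        fderiv ℝ (fderiv ℝ u) x (EuclideanSpace.single 1 1) (EuclideanSpace.single 1 1) =
      (-2 : ℝ) • u x)
    {x : EuclideanSpace ℝ (Fin 2)} {s M : ℝ} (hs : 0 < s) (hs1 : s ≤ 1) (hM : 0 < M)
    (hsub : closedBall x (k * s) ⊆ U)
    (hbound : ∀ y ∈ closedBall x (k * s), ‖u y‖ ≤ M) :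
    ‖iteratedFDeriv ℝ k u x‖ ≤ (10 / s) ^ k * M := by
  induction k generalizing F M with
  | zero => simpa using hbound x (by simp)
  | succ k ih =>
    have hball : ∀ y ∈ closedBall x (k * s), closedBall y s ⊆ closedBall x ((k + 1 : ℕ) * s) :=
      fun y hy ↦ closedBall_subset_closedBall' (by
        rw [mem_closedBall] at hy
        push_cast
        linarith)
    rw [← norm_iteratedFDeriv_fderiv, pow_succ, mul_assoc]
    refine ih (hu.fderiv_of_isOpen hU (by simp))
      (fun y hy ↦ laplacian_fderiv_eq hU (hu.of_le (by norm_cast)) hlap hy)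
      (by positivity) ((closedBall_subset_closedBall (by gcongr; simp)).trans hsub) ?_
    intro y hy
    exact norm_fderiv_le_of_laplacian_eq hU (hu.of_le (by norm_cast)) hlap hs hs1 hM
      ((hball y hy).trans hsub) fun z hz ↦ hbound z (hball y hy hz)

/-- A smooth map whose iterated derivatives of order `n` are bounded by `A * B ^ n * n!` near a
point is analytic at that point. -/
theorem analyticAt_of_norm_iteratedFDeriv_le {E F : Type*} [NormedAddCommGroup E] [NormedSpace ℝ E]
    [NormedAddCommGroup F] [NormedSpace ℝ F] [CompleteSpace F] {f : E → F} {x : E} {r A B : ℝ}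
    (hr : 0 < r) (hB : 0 < B) (hf : ∀ y ∈ ball x r, ContDiffAt ℝ (⊤ : ℕ∞) f y)
    (hbound : ∀ n : ℕ, ∀ y ∈ ball x r, ‖iteratedFDeriv ℝ n f y‖ ≤ A * B ^ n * n.factorial) :
    AnalyticAt ℝ f x := by
  have hA : 0 ≤ A := by
    have := (norm_nonneg _).trans (hbound 0 x (mem_ball_self hr))
    simpa using this
  set ρ : ℝ := min r B⁻¹ with hρ
  have hρ0 : 0 < ρ := lt_min hr (by positivity)
  set p : FormalMultilinearSeries ℝ E F :=
    fun n ↦ (n.factorial : ℝ)⁻¹ • iteratedFDeriv ℝ n f x with hp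
  refine ⟨p, ENNReal.ofReal ρ, ?_, by simpa using hρ0, fun {y} hy ↦ ?_⟩
  · refine p.le_radius_of_bound A fun n ↦ ?_
    rw [Real.coe_toNNReal _ hρ0.le, hp, norm_smul, norm_inv, RCLike.norm_natCast]
    calc (n.factorial : ℝ)⁻¹ * ‖iteratedFDeriv ℝ n f x‖ * ρ ^ n
        ≤ (n.factorial : ℝ)⁻¹ * (A * B ^ n * n.factorial) * B⁻¹ ^ n := by
          gcongr
          · exact hbound n x (mem_ball_self hr)
          · exact min_le_right _ _
      _ = A := by
          rw [inv_pow]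
          field_simp
  · have hyρ : ‖y‖ < ρ := by
      rw [eball_ofReal] at hy
      simpa using hy
    have hBy : B * ‖y‖ < 1 := by
      have := mul_lt_mul_of_pos_left (hyρ.trans_le (min_le_right _ _)) hB
      rwa [mul_inv_cancel₀ hB.ne'] at this
    have hseg : ∀ t ∈ Icc (0 : ℝ) 1, x + t • y ∈ ball x r := by
      intro t ht
      rw [mem_ball, dist_eq_norm, add_sub_cancel_left, norm_smul, Real.norm_of_nonneg ht.1]
      exact (mul_le_of_le_one_left (norm_nonneg _) ht.2).trans_lt (hyρ.trans_le (min_le_left _ _))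
    have hsum : Summable fun n : ℕ ↦ p n fun _ : Fin n ↦ y := by
      refine Summable.of_norm_bounded (g := fun n ↦ A * (B * ‖y‖) ^ n)
        ((summable_geometric_of_lt_one (by positivity) hBy).mul_left A) fun n ↦ ?_
      rw [hp, smul_apply, norm_smul, norm_inv, RCLike.norm_natCast]
      calc (n.factorial : ℝ)⁻¹ * ‖iteratedFDeriv ℝ n f x fun _ ↦ y‖
          ≤ (n.factorial : ℝ)⁻¹ * (A * B ^ n * n.factorial * ‖y‖ ^ n) := by
            gcongr
            refine (ContinuousMultilinearMap.le_opNorm _ _).trans ?_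
            simp only [Finset.prod_const, Finset.card_univ, Fintype.card_fin]
            gcongr
            exact hbound n x (mem_ball_self hr)
        _ = A * (B * ‖y‖) ^ n := by
            rw [mul_pow]
            field_simp
    refine hsum.hasSum_iff_tendsto_nat.2 ?_
    rw [← tendsto_add_atTop_iff_nat 1, tendsto_iff_norm_sub_tendsto_zero]
    have hlim : Tendsto (fun n : ℕ ↦ A * (((n + 1 : ℕ) : ℝ) * (B * ‖y‖) ^ (n + 1))) atTop (𝓝 0) := by
      have := (tendsto_self_mul_const_pow_of_lt_one (r := B * ‖y‖) (by positivity) hBy).const_mul A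
      rw [mul_zero] at this
      exact (tendsto_add_atTop_iff_nat 1).2 this
    refine squeeze_zero (fun _ ↦ norm_nonneg _) (fun n ↦ ?_) hlim
    rw [map_add_eq_sum_add_integral_iteratedFDeriv (n := n) (f := f) (x := x) (y := y)
      fun t ht ↦ (hf _ (hseg t ht)).of_le (by exact_mod_cast le_top)]
    simp only [hp, smul_apply]
    rw [sub_add_cancel_left, norm_neg, norm_smul, norm_inv, RCLike.norm_natCast]
    have hint : ‖∫ t in (0 : ℝ)..1, (1 - t) ^ n • iteratedFDeriv ℝ (n + 1) f (x + t • y) fun _ ↦ y‖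
        ≤ A * B ^ (n + 1) * (n + 1).factorial * ‖y‖ ^ (n + 1) * |1 - 0| := by
      refine intervalIntegral.norm_integral_le_of_norm_le_const fun t ht ↦ ?_
      rw [uIoc_of_le zero_le_one] at ht
      have ht' : t ∈ Icc (0 : ℝ) 1 := Ioc_subset_Icc_self ht
      have h₁ : ‖(1 - t) ^ n‖ ≤ 1 := by
        rw [norm_pow, Real.norm_of_nonneg (by linarith [ht.2])]
        exact pow_le_one₀ (by linarith [ht.2]) (by linarith [ht.1])
      rw [norm_smul]
      refine (mul_le_of_le_one_left (norm_nonneg _) h₁).trans ?_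
      refine (ContinuousMultilinearMap.le_opNorm _ _).trans ?_
      simp only [Finset.prod_const, Finset.card_univ, Fintype.card_fin]
      gcongr
      exact hbound (n + 1) _ (hseg t ht')
    calc (n.factorial : ℝ)⁻¹ * ‖∫ t in (0 : ℝ)..1,
          (1 - t) ^ n • iteratedFDeriv ℝ (n + 1) f (x + t • y) fun _ ↦ y‖
        ≤ (n.factorial : ℝ)⁻¹ *
            (A * B ^ (n + 1) * (n + 1).factorial * ‖y‖ ^ (n + 1) * |1 - 0|) := by gcongr
      _ = A * (((n + 1 : ℕ) : ℝ) * (B * ‖y‖) ^ (n + 1)) := by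
          rw [Nat.factorial_succ, sub_zero, abs_one, mul_pow]
          push_cast
          field_simp

/-- Analyticity of Hilbert-space-valued eigenfunctions of the Laplacian: if `u : ℝ² → H` is
smooth on an open set `U` and satisfies `Δu = -2u` on `U`, then `u` is real-analytic on `U`,
i.e. around every point of `U` it is given by a convergent power series with values in `H`. -/
theorem eigenfunction_real_analytic
    (H : Type*) [NormedAddCommGroup H] [InnerProductSpace ℝ H]
    [CompleteSpace H] [TopologicalSpace.SeparableSpace H]
    (U : Set (EuclideanSpace ℝ (Fin 2))) (hU : IsOpen U)
    (u : EuclideanSpace ℝ (Fin 2) → H)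
    (hu : ContDiffOn ℝ (⊤ : ℕ∞) u U)
    (hlap : ∀ x ∈ U,
      iteratedFDerivWithin ℝ 2 u U x
          ![EuclideanSpace.single (0 : Fin 2) (1 : ℝ), EuclideanSpace.single (0 : Fin 2) (1 : ℝ)] +
        iteratedFDerivWithin ℝ 2 u U x
          ![EuclideanSpace.single (1 : Fin 2) (1 : ℝ), EuclideanSpace.single (1 : Fin 2) (1 : ℝ)]
        = (-2 : ℝ) • u x) :
    AnalyticOnNhd ℝ u U := by
  intro x hx
  have hlap' : ∀ y ∈ U,
      fderiv ℝ (fderiv ℝ u) y (EuclideanSpace.single 0 1) (EuclideanSpace.single 0 1) +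
        fderiv ℝ (fderiv ℝ u) y (EuclideanSpace.single 1 1) (EuclideanSpace.single 1 1) =
      (-2 : ℝ) • u y := by
    intro y hy
    have h := hlap y hy
    rw [iteratedFDerivWithin_of_isOpen 2 hU hy, iteratedFDeriv_two_apply,
      iteratedFDeriv_two_apply] at h
    simpa using h
  obtain ⟨R, hR, hRU⟩ := nhds_basis_closedBall.mem_iff.1 (hU.mem_nhds hx)
  obtain ⟨C, hC⟩ := (isCompact_closedBall x R).exists_bound_of_continuousOn
    (hu.continuousOn.mono hRU)
  set M : ℝ := max C 1
  have hM : 0 < M := lt_max_of_lt_right one_pos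
  set r : ℝ := min (R / 2) 1
  have hr : 0 < r := lt_min (by positivity) one_pos
  have hball : ∀ y ∈ ball x r, closedBall y r ⊆ closedBall x R := fun y hy ↦
    closedBall_subset_closedBall' (by
      rw [mem_ball] at hy
      linarith [min_le_left (R / 2) 1])
  refine analyticAt_of_norm_iteratedFDeriv_le (r := r) (A := M) (B := 10 / r * Real.exp 1) hr
    (by positivity) (fun y hy ↦ hu.contDiffAt (hU.mem_nhds
      (hRU (hball y hy (mem_closedBall_self hr.le))))) fun n y hy ↦ ?_
  rcases n.eq_zero_or_pos with rfl | hn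
  · simpa [M] using Or.inl (hC y (hball y hy (mem_closedBall_self hr.le)))
  have hn' : (1 : ℝ) ≤ n := by exact_mod_cast hn
  have hnr : (n : ℝ) * (r / n) = r := by field_simp
  have hle := norm_iteratedFDeriv_le_of_laplacian_eq n hU hu hlap' (x := y) (s := r / n) (M := M)
    (by positivity) ((div_le_one (by positivity)).2 ((min_le_right _ _).trans hn')) hM
    (by rw [hnr]; exact (hball y hy).trans hRU)
    (by rw [hnr]; exact fun z hz ↦ (hC z (hball y hy hz)).trans (le_max_left _ _))
  have hexp : (n : ℝ) ^ n ≤ Real.exp 1 ^ n * n.factorial := by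
    rw [← Real.exp_nat_mul, mul_one, ← div_le_iff₀ (by positivity)]
    exact Real.pow_div_factorial_le_exp _ (by positivity) n
  calc ‖iteratedFDeriv ℝ n u y‖ ≤ (10 / (r / n)) ^ n * M := hle
    _ = (10 / r) ^ n * (n : ℝ) ^ n * M := by rw [← mul_pow]; congr 2; field_simp
    _ ≤ (10 / r) ^ n * (Real.exp 1 ^ n * n.factorial) * M := by gcongr
    _ = M * (10 / r * Real.exp 1) ^ n * n.factorial := by rw [mul_pow]; ring
end
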